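/- For all integers k ≥ 1, r ≥ 3, a ∈ {1,…,r−1}, b ∈ {1,…,r−2} with a ≡ b (mod 2), the following identity of formal power series in q holds: χ^{(r,(k+1)r−1)}_{a,(k+1)b}(q) = f_{a,b} · q^{−k(a−b)²/4} Σ_{n ∈ (ℤ_{≥0})^k} Σ_{m ≡ Q_{a,b}} ( q^{nᵀB n} / ((q)_{n_1} ⋯ (q)_{n_{k−1}} (q)_{2n_k}) ) · q^{(1/4) mᵀC m − (1/2) m_{r−a−1}} ∏_{j=1}^{r−3} [ (1/2)(I m + 2n_k e_1 + e_{r−a−1} + e_{r−b−1})_j ; m_j ] (all exponents occurring are integers). -/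

import Mathlib

attribute [local instance] Classical.propDecidable

noncomputable section

variable {K : Type*} [Field K]

/-- `(q)_n` where `q = t^4` (the variable `t` stands for `q^{1/4}`). -/
def qp (t : K) (n : ℕ) : K :=
  ∏ k ∈ Finset.range n, (1 - t ^ (4 * (k + 1)))

/-- Gaussian polynomial `[N; m]` in the variable `q = t^4`. -/
def gauss (t : K) (N m : ℤ) : K :=
  if 0 ≤ m ∧ m ≤ N then qp t N.toNat / (qp t m.toNat * qp t (N - m).toNat) else 0

/-- Gaussian polynomial `[N2/2; m]` (zero if `N2` is odd). -/
def gaussHalf (t : K) (N2 m : ℤ) : K :=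
  if N2 % 2 = 0 then gauss t (N2 / 2) m else 0

/-- Incidence matrix of the Dynkin diagram `A_d` (indices `i : Fin d` stand for `i+1`). -/
def inc (d : ℕ) (i k : Fin d) : ℤ := if (i : ℕ) + 1 = (k : ℕ) ∨ (k : ℕ) + 1 = (i : ℕ) then 1 else 0

/-- Cartan matrix of `A_d`. -/
def cartan (d : ℕ) (i k : Fin d) : ℤ := (if i = k then 2 else 0) - inc d i k

/-- the `s`-th unit vector, with the convention `e_0 = e_{d+1} = 0`. -/
def uv (d : ℕ) (s : ℤ) (i : Fin d) : ℤ := if ((i : ℕ) : ℤ) + 1 = s then 1 else 0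

/-- `m_s`, with the conventions `m_0 = m_{d+1} = 0`. -/
def mAt (d : ℕ) (m : Fin d → ℕ) (s : ℤ) : ℤ := ∑ i, uv d s i * (m i : ℤ)

/-- `mᵀ C m` for the `A_d` Cartan matrix. -/
def quadC (d : ℕ) (m : Fin d → ℕ) : ℤ := ∑ i, ∑ k, (m i : ℤ) * cartan d i k * (m k : ℤ)

/-- the vector `Q_{a,b}`. -/
def Qab (r a b : ℕ) (i : Fin (r - 3)) : ℕ :=
  min (a - 1) (r - ((i : ℕ) + 1) - 2) + min (b - 1) (r - ((i : ℕ) + 1) - 2)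

/-- the parity restriction `m ≡ Q_{a,b} (mod 2)`. -/
def parity (r a b : ℕ) (m : Fin (r - 3) → ℕ) : Prop := ∀ i, m i % 2 = Qab r a b i % 2

/-- `(I m + L e_1 + e_{r-a-1} + e_{r-b-1})_i`. -/
def topE (r a b L : ℕ) (m : Fin (r - 3) → ℕ) (i : Fin (r - 3)) : ℤ :=
  (∑ k, inc (r - 3) i k * (m k : ℤ)) + (L : ℤ) * uv (r - 3) 1 i
    + uv (r - 3) ((r : ℤ) - a - 1) i + uv (r - 3) ((r : ℤ) - b - 1) i

/-- the summand `q^{(1/4) mᵀCm - (1/2) m_{r-a-1}} ∏_j [(1/2)(Im + Le_1 + e_{r-a-1} + e_{r-b-1})_j; m_j]`,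
in the variable `t = q^{1/4}`. -/
def fermTerm (r a b L : ℕ) (t : K) (m : Fin (r - 3) → ℕ) : K :=
  t ^ (quadC (r - 3) m - 2 * mAt (r - 3) m ((r : ℤ) - a - 1))
    * ∏ i, gaussHalf t (topE r a b L m i) (m i)

/-- the fermionic sum `Σ_{m ≡ Q_{a,b}} (⋯)`. -/
def fermSum (r a b L : ℕ) (t : K) : K :=
  ∑ᶠ m : Fin (r - 3) → ℕ, if parity r a b m then fermTerm r a b L t m else 0

/-- `(I m + c e_1 + e_{r-a-1} + e_{r-b-1})_i`. -/
def topC (r a b : ℕ) (c : ℤ) (m : Fin (r - 3) → ℕ) (i : Fin (r - 3)) : ℤ :=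
  (∑ k, inc (r - 3) i k * (m k : ℤ)) + c * uv (r - 3) 1 i
    + uv (r - 3) ((r : ℤ) - a - 1) i + uv (r - 3) ((r : ℤ) - b - 1) i

/-- `m_s` as a natural number (zero if `s` is out of range). -/
def mAtN (d : ℕ) (m : Fin d → ℕ) (s : ℕ) : ℕ :=
  ∑ i : Fin d, if (i : ℕ) + 1 = s then m i else 0

/-- the bilinear form `vᵀ B w` with `B_{j,ℓ} = min(j,ℓ)` (tadpole inverse Cartan matrix). -/
def tadB (k : ℕ) (v w : Fin k → ℤ) : ℤ :=
  ∑ i : Fin k, ∑ l : Fin k, v i * (min ((i : ℕ) + 1) ((l : ℕ) + 1) : ℤ) * w l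

/-- the variable `t = q^{1/4}` in the field of formal Laurent series `ℚ⸨X⸩`. -/
def tL : LaurentSeries ℚ := HahnSeries.single 1 1

/-- the Euler product `(q)_∞ = ∏_{k ≥ 1} (1 - q^k)` with `q = t^4`. -/
def eulerInf : LaurentSeries ℚ := ∏' k : ℕ, (1 - tL ^ (4 * (k + 1)))

/-- the normalized Virasoro character `χ^{(p,p')}_{R,S}(q)`, written in the variable
`t = q^{1/4}` (all exponents multiplied by `4`). -/
def virChar (p p' R S : ℕ) : LaurentSeries ℚ :=
  eulerInf⁻¹ * ∑' j : ℤ,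
    (tL ^ (4 * (j * ((p : ℤ) * p' * j + (p' : ℤ) * R - (p : ℤ) * S)))
      - tL ^ (4 * ((j * p + R) * (j * p' + S))))


/-- `1/(q)_n`, zero for negative `n`. -/
def iq (t : K) (n : ℤ) : K := if 0 ≤ n then (qp t n.toNat)⁻¹ else 0

/-- `t` is neither zero nor a root of unity (of order dividing a multiple of four). -/
def Good (t : K) : Prop := t ≠ 0 ∧ ∀ n : ℕ, 1 - t ^ (4 * (n + 1)) ≠ 0

lemma qp_succ (t : K) (n : ℕ) : qp t (n + 1) = qp t n * (1 - t ^ (4 * (n + 1))) := by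
  unfold qp; rw [Finset.prod_range_succ]

lemma qp_zero (t : K) : qp t 0 = 1 := by simp [qp]

lemma qp_ne {t : K} (ht : Good t) (n : ℕ) : qp t n ≠ 0 := by
  unfold qp
  exact Finset.prod_ne_zero_iff.2 fun k _ => ht.2 k

lemma iq_neg (t : K) {n : ℤ} (h : n < 0) : iq t n = 0 := by simp [iq, h]

lemma iq_nat (t : K) (n : ℕ) : iq t n = (qp t n)⁻¹ := by simp [iq]

lemma iq_zero (t : K) : iq t 0 = 1 := by simp [iq, qp_zero]

lemma iq_pred {t : K} (ht : Good t) (n : ℤ) : iq t (n - 1) = (1 - t ^ (4 * n)) * iq t n := by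
  rcases lt_trichotomy n 0 with h | h | h
  · rw [iq_neg t h, iq_neg t (by omega), mul_zero]
  · subst h; simp [iq]
  · obtain ⟨m, rfl⟩ : ∃ m : ℕ, n = m + 1 := ⟨(n - 1).toNat, by omega⟩
    have e : ((m : ℤ) + 1) = ((m + 1 : ℕ) : ℤ) := by push_cast; ring
    rw [add_sub_cancel_right, e, iq_nat, iq_nat, qp_succ]
    have h1 := ht.2 m
    have h2 := qp_ne ht m
    have e2 : t ^ (4 * ((m + 1 : ℕ) : ℤ)) = t ^ (4 * (m + 1)) := by
      rw [← zpow_natCast]; push_cast; rfl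
    rw [e2]
    field_simp

lemma gauss_eq (t : K) {N : ℤ} (_hN : 0 ≤ N) (m : ℤ) :
    gauss t N m = qp t N.toNat * (iq t m * iq t (N - m)) := by
  unfold gauss iq
  by_cases h1 : 0 ≤ m <;> by_cases h2 : m ≤ N <;> simp [h1, h2, div_eq_mul_inv, mul_comm]

lemma gauss_neg (t : K) {N : ℤ} (hN : N < 0) (m : ℤ) : gauss t N m = 0 := by
  unfold gauss; rw [if_neg]; omega

lemma gauss_neg_right (t : K) (N : ℤ) {m : ℤ} (hm : m < 0) : gauss t N m = 0 := by
  unfold gauss; rw [if_neg]; omega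

lemma qp_toNat (t : K) {N : ℤ} (hN : 1 ≤ N) :
    qp t N.toNat = qp t (N - 1).toNat * (1 - t ^ (4 * N)) := by
  obtain ⟨m, rfl⟩ : ∃ m : ℕ, N = m + 1 := ⟨(N - 1).toNat, by omega⟩
  have e : ((m : ℤ) + 1).toNat = m + 1 := by omega
  have e1 : ((m : ℤ) + 1 - 1).toNat = m := by omega
  rw [e, e1, qp_succ]
  congr 2
  rw [← zpow_natCast]; push_cast; rfl

lemma gauss_pascal {t : K} (ht : Good t) {N : ℤ} (hN : N ≠ 0) (m : ℤ) :
    gauss t N m = gauss t (N - 1) m + t ^ (4 * (N - m)) * gauss t (N - 1) (m - 1) := by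
  rcases lt_or_gt_of_ne hN with h | h
  · rw [gauss_neg t h, gauss_neg t (by omega), gauss_neg t (by omega)]; simp
  · rw [gauss_eq t h.le, gauss_eq t (by omega), gauss_eq t (by omega), qp_toNat t h,
      iq_pred ht m, show N - 1 - m = (N - m) - 1 by ring, iq_pred ht (N - m),
      show N - 1 - (m - 1) = N - m by ring,
      show 4 * N = 4 * (N - m) + 4 * m by ring, zpow_add₀ ht.1]
    ring

/-- the three term recursion of Gaussian polynomials. -/
lemma gauss_three {t : K} (ht : Good t) {N : ℤ} (hN : 2 ≤ N) (m : ℤ) :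
    gauss t N m = t ^ (4 * m) * gauss t (N - 1) m + t ^ (4 * (N - m)) * gauss t (N - 1) (m - 1)
      + (1 - t ^ (4 * (N - 1))) * gauss t (N - 2) (m - 1) := by
  rw [gauss_eq t (by omega : 0 ≤ N), gauss_eq t (by omega), gauss_eq t (by omega),
    gauss_eq t (by omega), qp_toNat t (by omega : 1 ≤ N), qp_toNat t (by omega : 1 ≤ N - 1),
    show N - 1 - 1 = N - 2 by ring, show N - 1 - m = (N - m) - 1 by ring,
    show N - 1 - (m - 1) = N - m by ring, show N - 2 - (m - 1) = N - m - 1 by ring,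
    iq_pred ht m, iq_pred ht (N - m), show 4 * N = 4 * (N - m) + 4 * m by ring, zpow_add₀ ht.1]
  ring

lemma gauss_three_one {t : K} (ht : Good t) (m : ℤ) :
    gauss t 1 m = t ^ (4 * m) * gauss t 0 m + t ^ (4 * (1 - m)) * gauss t 0 (m - 1) := by
  have h0 : iq t (m - 1) * iq t ((1 - m) - 1) = 0 := by
    rcases lt_or_ge m 1 with h | h
    · rw [iq_neg t (by omega : m - 1 < 0), zero_mul]
    · rw [iq_neg t (by omega : 1 - m - 1 < 0), mul_zero]
  rw [iq_pred ht m, iq_pred ht (1 - m)] at h0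
  rw [gauss_eq t (by omega), gauss_eq t (by omega), gauss_eq t (by omega), qp_toNat t le_rfl,
    iq_pred ht m, show 0 - m = (1 - m) - 1 by ring, show 0 - (m - 1) = 1 - m by ring,
    iq_pred ht (1 - m), show (4 : ℤ) * 1 = 4 * (1 - m) + 4 * m by ring, zpow_add₀ ht.1,
    show ((1 : ℤ) - 1).toNat = (0 : ℤ).toNat by simp]
  linear_combination qp t (0 : ℤ).toNat * h0

lemma gauss_symm (t : K) (N m : ℤ) : gauss t N (N - m) = gauss t N m := by
  rcases lt_or_ge N 0 with h | h
  · rw [gauss_neg t h, gauss_neg t h]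
  · rw [gauss_eq t h, gauss_eq t h, sub_sub_cancel, mul_comm (iq t m)]

/-- Pascal in the other direction -/
lemma gauss_pascal' {t : K} (ht : Good t) {N : ℤ} (hN : N ≠ 0) (m : ℤ) :
    gauss t N m - t ^ (4 * m) * gauss t (N - 1) m = gauss t (N - 1) (m - 1) := by
  have h := gauss_pascal ht hN (N - m)
  rw [gauss_symm, sub_sub_cancel] at h
  rw [h, show N - m - 1 = (N - 1) - m by ring, gauss_symm,
    show N - m = (N - 1) - (m - 1) by ring, gauss_symm]
  ring

/-- the unit vector at site `j` -/
def se (d : ℕ) (j i : Fin d) : ℤ := if i = j then 1 else 0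

lemma se_self (d : ℕ) (j : Fin d) : se d j j = 1 := by simp [se]

lemma inc_eq_uv (d : ℕ) (i k : Fin d) : inc d i k = uv d (i : ℕ) k + uv d ((i : ℕ) + 2) k := by
  unfold inc uv
  split_ifs <;> omega

lemma inc_symm (d : ℕ) (i k : Fin d) : inc d i k = inc d k i := by
  unfold inc; congr 1; apply propext; tauto

lemma cartan_symm (d : ℕ) (i k : Fin d) : cartan d i k = cartan d k i := by
  unfold cartan; rw [inc_symm]; simp only [eq_comm]

lemma cartan_self (d : ℕ) (i : Fin d) : cartan d i i = 2 := by
  unfold cartan inc; simp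

/-- the value `f_s` with zero boundary conditions -/
def at' (d : ℕ) (f : Fin d → ℤ) (s : ℤ) : ℤ := ∑ i, uv d s i * f i

lemma at'_val (d : ℕ) (f : Fin d → ℤ) (i : Fin d) (s : ℤ) (h : s = (i : ℕ) + 1) :
    at' d f s = f i := by
  unfold at'
  rw [Finset.sum_eq_single i]
  · simp [uv, h]
  · intro k _ hk
    have : ¬ (((k : ℕ) : ℤ) + 1 = s) := by
      intro h'; apply hk; ext; omega
    simp [uv, this]
  · simp

lemma at'_out (d : ℕ) (f : Fin d → ℤ) (s : ℤ) (h : s ≤ 0 ∨ (d : ℤ) + 1 ≤ s) : at' d f s = 0 := by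
  unfold at'
  apply Finset.sum_eq_zero
  intro k _
  have := k.2
  have : ¬ (((k : ℕ) : ℤ) + 1 = s) := by omega
  simp [uv, this]

lemma sum_inc (d : ℕ) (f : Fin d → ℤ) (i : Fin d) :
    ∑ k, inc d i k * f k = at' d f (i : ℕ) + at' d f ((i : ℕ) + 2) := by
  unfold at'
  rw [← Finset.sum_add_distrib]
  exact Finset.sum_congr rfl fun k _ => by rw [inc_eq_uv]; ring

def quadZ (d : ℕ) (m : Fin d → ℤ) : ℤ := ∑ i, ∑ k, m i * cartan d i k * m k

def topZ (d : ℕ) (u m : Fin d → ℤ) (i : Fin d) : ℤ := (∑ k, inc d i k * m k) + u i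

def TZ (d : ℕ) (t : K) (u v w m : Fin d → ℤ) : K :=
  if ∀ i, (m i - w i) % 2 = 0 then
    t ^ (quadZ d m - 2 * ∑ i, v i * m i) * ∏ i, gaussHalf t (topZ d u m i) (m i)
  else 0

def GZ (d : ℕ) (t : K) (u v w : Fin d → ℤ) : K := ∑ᶠ m : Fin d → ℤ, TZ d t u v w m

lemma gaussHalf_ne {t : K} {N m : ℤ} (h : gaussHalf t N m ≠ 0) :
    N % 2 = 0 ∧ 0 ≤ m ∧ 2 * m ≤ N := by
  unfold gaussHalf gauss at h
  split_ifs at h with h1 h2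
  · omega
  · simp at h
  · simp at h

lemma TZ_ne {d : ℕ} {t : K} {u v w m : Fin d → ℤ} (h : TZ d t u v w m ≠ 0) :
    (∀ i, (m i - w i) % 2 = 0) ∧
    ∀ i, topZ d u m i % 2 = 0 ∧ 0 ≤ m i ∧ 2 * m i ≤ topZ d u m i := by
  unfold TZ at h
  split_ifs at h with h1
  · refine ⟨h1, fun i => ?_⟩
    have h2 := right_ne_zero_of_mul h
    rw [Finset.prod_ne_zero_iff] at h2
    exact gaussHalf_ne (h2 i (Finset.mem_univ i))
  · simp at h

lemma sum_bound {d : ℕ} {u m : Fin d → ℤ} (h : ∀ i, 2 * m i ≤ topZ d u m i) :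
    2 * ∑ i, m i ≤ ∑ i : Fin d, (((i : ℕ) : ℤ) + 1) * (d - (i : ℕ)) * u i := by
  set W : Fin d → ℤ := fun i => (((i : ℕ) : ℤ) + 1) * (d - (i : ℕ)) with hW
  have atW : ∀ s : ℤ, 0 ≤ s → s ≤ d + 1 → at' d W s = s * (d + 1 - s) := by
    intro s h0 h1
    rcases eq_or_lt_of_le h0 with h | h
    · rw [at'_out d W s (by omega), ← h]; ring
    rcases eq_or_lt_of_le h1 with h' | h'
    · rw [at'_out d W s (by omega), h']; ring
    · rw [at'_val d W ⟨(s - 1).toNat, by omega⟩ s (by simp; omega)]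
      simp only [hW]
      have : (((s - 1).toNat : ℕ) : ℤ) = s - 1 := by omega
      rw [this]; ring
  have h1 : ∑ i, W i * (2 * m i) ≤ ∑ i, W i * topZ d u m i := by
    apply Finset.sum_le_sum
    intro i _
    apply mul_le_mul_of_nonneg_left (h i)
    have := i.2
    exact mul_nonneg (by omega) (by omega)
  have h2 : ∑ i, W i * topZ d u m i = (∑ i, W i * ∑ k, inc d i k * m k) + ∑ i, W i * u i := by
    rw [← Finset.sum_add_distrib]
    exact Finset.sum_congr rfl fun i _ => by unfold topZ; ring
  have h3 : ∑ i, W i * ∑ k, inc d i k * m k = ∑ k, m k * (2 * W k - 2) := by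
    simp only [Finset.mul_sum]
    rw [Finset.sum_comm]
    refine Finset.sum_congr rfl fun k _ => ?_
    have : ∑ i, W i * (inc d i k * m k) = m k * ∑ i, inc d k i * W i := by
      rw [Finset.mul_sum]
      exact Finset.sum_congr rfl fun i _ => by rw [inc_symm d i k]; ring
    rw [this, sum_inc, atW _ (by omega) (by have := k.2; omega),
      atW _ (by omega) (by have := k.2; omega)]
    simp only [hW]
    ring
  have h4 : ∑ i, W i * (2 * m i) = (∑ k, m k * (2 * W k - 2)) + 2 * ∑ i, m i := by
    rw [Finset.mul_sum, ← Finset.sum_add_distrib]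
    exact Finset.sum_congr rfl fun i _ => by ring
  rw [h2, h3, h4] at h1
  linarith

lemma TZ_finite (d : ℕ) (t : K) (u v w : Fin d → ℤ) :
    (Function.support (TZ d t u v w)).Finite := by
  set B := ∑ i : Fin d, (((i : ℕ) : ℤ) + 1) * (d - (i : ℕ)) * u i
  apply (Set.finite_Icc (0 : Fin d → ℤ) (fun _ => B)).subset
  intro m hm
  have h := (TZ_ne hm).2
  have hb := sum_bound (fun i => (h i).2.2)
  refine ⟨fun i => (h i).2.1, fun i => ?_⟩
  have := Finset.single_le_sum (f := m) (fun i _ => (h i).2.1) (Finset.mem_univ i)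
  have h0 := (h i).2.1
  show m i ≤ B
  linarith

lemma quadZ_sub (d : ℕ) (m : Fin d → ℤ) (j : Fin d) :
    quadZ d (m - se d j) = quadZ d m - 2 * (2 * m j - ∑ k, inc d j k * m k) + 2 := by
  have hC : ∑ k, cartan d j k * m k = 2 * m j - ∑ k, inc d j k * m k := by
    unfold cartan
    simp [sub_mul, Finset.sum_sub_distrib]
  rw [← hC]
  unfold quadZ
  have e : ∀ i k, (m - se d j) i * cartan d i k * (m - se d j) k
      = m i * cartan d i k * m k - (if i = j then cartan d i k * m k else 0)
        - (if k = j then m i * cartan d i k else 0)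
        + (if i = j then (if k = j then cartan d i k else 0) else 0) := by
    intro i k
    simp only [Pi.sub_apply, se]
    split_ifs <;> ring
  simp only [e, Finset.sum_add_distrib, Finset.sum_sub_distrib]
  simp only [Finset.sum_ite_eq', Finset.mem_univ, if_true]
  have h1 : ∀ i, (∑ k, if i = j then cartan d i k * m k else 0)
      = if i = j then ∑ k, cartan d i k * m k else 0 := by
    intro i; split_ifs <;> simp
  have h2 : ∀ i, (∑ k, if i = j then (if k = j then cartan d i k else 0) else 0)
      = if i = j then 2 else 0 := by
    intro i
    split_ifs with h
    · subst h; simp [cartan_self]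
    · simp
  simp only [h1, h2, Finset.sum_ite_eq', Finset.mem_univ, if_true]
  have h3 : ∑ x, m x * cartan d x j = ∑ k, cartan d j k * m k :=
    Finset.sum_congr rfl fun k _ => by rw [cartan_symm]; ring
  rw [h3]; ring

lemma topZ_sub (d : ℕ) (u m : Fin d → ℤ) (j i : Fin d) :
    topZ d (u - fun i => cartan d i j) (m - se d j) i
      = topZ d u m i - 2 * (if i = j then 1 else 0) := by
  unfold topZ cartan
  have : ∑ k, inc d i k * (m - se d j) k = ∑ k, inc d i k * m k - inc d i j := by
    simp [mul_sub, Finset.sum_sub_distrib, se]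
  rw [this]
  simp only [Pi.sub_apply]
  split_ifs <;> ring

lemma gaussHalf_neg_right (t : K) (N : ℤ) {m : ℤ} (hm : m < 0) : gaussHalf t N m = 0 := by
  unfold gaussHalf; split_ifs
  · exact gauss_neg_right t _ hm
  · rfl

lemma TZ_peel {t : K} (ht : Good t) {d : ℕ} (u v w m : Fin d → ℤ) (j : Fin d) (hj : 1 ≤ u j) :
    TZ d t u v w m = TZ d t (u - 2 • se d j) v w m
      + t ^ (2 * (u j - v j - 1))
        * TZ d t (u - fun i => cartan d i j) v (w - se d j) (m - se d j) := by
  unfold TZ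
  have hp : (∀ i, ((m - se d j) i - (w - se d j) i) % 2 = 0)
      ↔ ∀ i, (m i - w i) % 2 = 0 := by
    simp
  simp only [hp]
  split_ifs with hpar
  swap
  · simp
  have tops : ∀ i, topZ d (u - 2 • se d j) m i = topZ d u m i - 2 * (if i = j then 1 else 0) := by
    intro i; unfold topZ; simp [se]; ring
  rw [← Finset.mul_prod_erase Finset.univ _ (Finset.mem_univ j),
    ← Finset.mul_prod_erase Finset.univ _ (Finset.mem_univ j),
    ← Finset.mul_prod_erase Finset.univ
      (fun i => gaussHalf t (topZ d (u - fun i => cartan d i j) (m - se d j) i)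
        ((m - se d j) i)) (Finset.mem_univ j)]
  have r1 : ∏ x ∈ Finset.univ.erase j, gaussHalf t (topZ d (u - 2 • se d j) m x) (m x)
      = ∏ x ∈ Finset.univ.erase j, gaussHalf t (topZ d u m x) (m x) := by
    refine Finset.prod_congr rfl fun i hi => ?_
    rw [tops, if_neg (Finset.ne_of_mem_erase hi)]; simp
  have r2 : ∏ x ∈ Finset.univ.erase j, gaussHalf t
      (topZ d (u - fun i => cartan d i j) (m - se d j) x) ((m - se d j) x)
      = ∏ x ∈ Finset.univ.erase j, gaussHalf t (topZ d u m x) (m x) := by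
    refine Finset.prod_congr rfl fun i hi => ?_
    rw [topZ_sub, if_neg (Finset.ne_of_mem_erase hi)]
    simp [se, Finset.ne_of_mem_erase hi]
  rw [r1, r2, tops, topZ_sub]
  by_cases hneg : ∃ i, i ≠ j ∧ m i < 0
  · obtain ⟨i, hij, hi⟩ := hneg
    have : ∏ x ∈ Finset.univ.erase j, gaussHalf t (topZ d u m x) (m x) = 0 :=
      Finset.prod_eq_zero (Finset.mem_erase.2 ⟨hij, Finset.mem_univ i⟩)
        (gaussHalf_neg_right t _ hi)
    rw [this]; simp
  push Not at hneg
  have hS : 0 ≤ ∑ k, inc d j k * m k := by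
    apply Finset.sum_nonneg
    intro k _
    by_cases hk : k = j
    · subst hk; simp [inc]
    · apply mul_nonneg _ (hneg k hk)
      unfold inc; split_ifs <;> simp
  have hE : quadZ d (m - se d j) - 2 * ∑ i, v i * (m - se d j) i
      = (quadZ d m - 2 * ∑ i, v i * m i) - 2 * (2 * m j - ∑ k, inc d j k * m k) + 2 + 2 * v j := by
    rw [quadZ_sub]
    simp [mul_sub, Finset.sum_sub_distrib, se]
    ring
  rw [hE]
  set E := quadZ d m - 2 * ∑ i, v i * m i
  simp only [if_true, Pi.sub_apply, se_self]
  have hN : topZ d u m j = (∑ k, inc d j k * m k) + u j := rfl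
  have key : gaussHalf t (topZ d u m j) (m j) = gaussHalf t (topZ d u m j - 2 * 1) (m j)
      + t ^ (2 * (topZ d u m j) - 4 * m j) * gaussHalf t (topZ d u m j - 2 * 1) (m j - 1) := by
    unfold gaussHalf
    by_cases hpar : topZ d u m j % 2 = 0
    · have h2 : (topZ d u m j - 2 * 1) % 2 = 0 := by omega
      rw [if_pos hpar, if_pos h2, if_pos h2, show (topZ d u m j - 2 * 1) / 2 = topZ d u m j / 2 - 1 by omega,
        gauss_pascal ht (by omega)]
      congr 3; omega
    · have h2 : ¬ (topZ d u m j - 2 * 1) % 2 = 0 := by omega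
      rw [if_neg hpar, if_neg h2, if_neg h2]; simp
  rw [key]
  have hpow : t ^ (2 * (u j - v j - 1)) * t ^ (E - 2 * (2 * m j - ∑ k, inc d j k * m k) + 2 + 2 * v j)
      = t ^ E * t ^ (2 * (topZ d u m j) - 4 * m j) := by
    rw [← zpow_add₀ ht.1, ← zpow_add₀ ht.1, hN]
    congr 1; ring
  linear_combination (-1 : K) * gaussHalf t (topZ d u m j - 2 * 1) (m j - 1)
    * (∏ x ∈ Finset.univ.erase j, gaussHalf t (topZ d u m x) (m x)) * hpow

lemma GZ_peel {t : K} (ht : Good t) {d : ℕ} (u v w : Fin d → ℤ) (j : Fin d) (hj : 1 ≤ u j) :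
    GZ d t u v w = GZ d t (u - 2 • se d j) v w
      + t ^ (2 * (u j - v j - 1)) * GZ d t (u - fun i => cartan d i j) v (w - se d j) := by
  unfold GZ
  rw [← finsum_comp_equiv (Equiv.subRight (se d j))
    (f := TZ d t (u - fun i => cartan d i j) v (w - se d j)), mul_finsum, ← finsum_add_distrib]
  · refine finsum_congr fun m => ?_
    rw [TZ_peel ht u v w m j hj]; rfl
  · exact TZ_finite ..
  · have := TZ_finite d t (u - fun i => cartan d i j) v (w - se d j)
    refine (this.preimage (f := Equiv.subRight (se d j))
      (Equiv.injective _).injOn).subset ?_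
    intro m hm
    exact right_ne_zero_of_mul hm

lemma GZ_congr_w {t : K} {d : ℕ} (u v w w' : Fin d → ℤ) (h : ∀ i, (w i - w' i) % 2 = 0) :
    GZ d t u v w = GZ d t u v w' := by
  unfold GZ
  refine finsum_congr fun m => ?_
  unfold TZ
  congr 1
  apply propext
  refine forall_congr' fun i => ?_
  have := h i
  omega

lemma se_eq_uv (d : ℕ) (j : ℤ) (k : Fin d) (h : ((k : ℕ) : ℤ) + 1 = j) (i : Fin d) :
    se d k i = uv d j i := by
  have : i = k ↔ ((i : ℕ) : ℤ) + 1 = j := by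
    rw [Fin.ext_iff]; omega
  simp [se, uv, this]

lemma cartan_eq_uv (d : ℕ) (j : ℤ) (k : Fin d) (h : ((k : ℕ) : ℤ) + 1 = j) (i : Fin d) :
    cartan d i k = 2 * uv d j i - uv d (j - 1) i - uv d (j + 1) i := by
  have : i = k ↔ ((i : ℕ) : ℤ) + 1 = j := by
    rw [Fin.ext_iff]; omega
  simp only [cartan, inc, uv, this]
  split_ifs <;> omega

/-- the sum with an additional source at `p`. -/
def HZ (d : ℕ) (t : K) (p : ℤ) (x w : Fin d → ℤ) : K :=
  GZ d t (fun i => x i + uv d p i) (uv d p) w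

lemma HZ_peel {t : K} (ht : Good t) {d : ℕ} (p : ℤ) (j : ℤ) (hj1 : 1 ≤ j) (hj2 : j ≤ d)
    (c : ℤ) (hc : 1 ≤ c) (x x1 x2 w w2 : Fin d → ℤ)
    (hx : ∀ i : Fin d, ((i : ℕ) : ℤ) + 1 = j → x i = c)
    (h1 : ∀ i, x1 i = x i - 2 * uv d j i)
    (h2 : ∀ i, x2 i = x i - 2 * uv d j i + uv d (j - 1) i + uv d (j + 1) i)
    (hw : ∀ i, ((w i - uv d j i) - w2 i) % 2 = 0) :
    HZ d t p x w = HZ d t p x1 w + t ^ (2 * (c - 1)) * HZ d t p x2 w2 := by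
  have hk : (((⟨(j - 1).toNat, by omega⟩ : Fin d) : ℕ) : ℤ) + 1 = j := by simp; omega
  set k : Fin d := ⟨(j - 1).toNat, by omega⟩
  have hxk := hx k hk
  have huv : 0 ≤ uv d p k := by unfold uv; split_ifs <;> simp
  unfold HZ
  rw [GZ_peel ht _ _ w k (by show 1 ≤ x k + uv d p k; omega)]
  have e : 2 * ((fun i => x i + uv d p i) k - uv d p k - 1) = 2 * (c - 1) := by
    simp only [hxk]; ring
  rw [e]
  congr 2
  · congr 1
    funext i
    have := se_eq_uv d j k hk i
    have := h1 i
    simp; omega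
  · rw [GZ_congr_w _ _ (w - se d k) w2]
    · congr 1
      funext i
      have := cartan_eq_uv d j k hk i
      have := h2 i
      simp only [Pi.sub_apply]
      omega
    · intro i
      have := se_eq_uv d j k hk i
      have := hw i
      simp only [Pi.sub_apply]
      omega

lemma HZ_congr {t : K} {d : ℕ} (p : ℤ) (x x1 w w1 : Fin d → ℤ) (h1 : ∀ i, x i = x1 i)
    (hw : ∀ i, (w i - w1 i) % 2 = 0) : HZ d t p x w = HZ d t p x1 w1 := by
  unfold HZ
  rw [GZ_congr_w _ _ w w1 hw]
  congr 1
  funext i; rw [h1]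

/-- the fermionic sum with sources `L e_1 + e_l + e_p`. -/
def FZ (d : ℕ) (t : K) (p L l : ℤ) : K :=
  HZ d t p (fun i => L * uv d 1 i + uv d l i)
    (fun i => max p (((i : ℕ) : ℤ) + 1) + max l (((i : ℕ) : ℤ) + 1))

lemma FZ_zero {t : K} {d : ℕ} (p L : ℤ) : FZ d t p L 0 = FZ d t p (L - 1) 1 := by
  unfold FZ
  apply HZ_congr
  · intro i; simp only [uv]; split_ifs <;> omega
  · intro i; omega

lemma FZ_one_of_zero {t : K} (p L L' : ℤ) : FZ 0 t p L 1 = FZ 0 t p L' 1 := by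
  unfold FZ
  apply HZ_congr
  · intro i; exact i.elim0
  · intro i; exact i.elim0

lemma FZ_one {t : K} (ht : Good t) {d : ℕ} (hd : 1 ≤ d) (p L : ℤ) (hL : 1 ≤ L) :
    FZ d t p L 1 = t ^ (2 * L) * FZ d t p (L - 1) 2 + FZ d t p (L - 2) 1 := by
  unfold FZ
  rw [HZ_peel ht p 1 le_rfl (by omega) (L + 1) (by omega) _
    (fun i => (L - 2) * uv d 1 i + uv d 1 i) (fun i => (L - 1) * uv d 1 i + uv d 2 i) _
    (fun i => max p (((i : ℕ) : ℤ) + 1) + max 2 (((i : ℕ) : ℤ) + 1))]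
  · rw [add_comm, add_sub_cancel_right]
  · intro i hi; simp [uv, hi]
  · intro i; ring
  · intro i; simp only [uv]; split_ifs <;> omega
  · intro i; simp only [uv]; split_ifs <;> omega

lemma FZ_rec {t : K} (ht : Good t) {d : ℕ} (p L l : ℤ) (hL : 1 ≤ L) (hl : 2 ≤ l)
    (hl' : l ≤ d + 1) :
    FZ d t p L l = t ^ (2 * L) * (if l ≤ d then FZ d t p (L - 1) (l + 1) else 0)
      + t ^ (2 * (L - 1)) * FZ d t p (L - 1) (l - 1)
      + (1 - t ^ (4 * (L - 1))) * FZ d t p (L - 2) l := by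
  let w : ℤ → Fin d → ℤ := fun n i => max p (((i : ℕ) : ℤ) + 1) + max l (((i : ℕ) : ℤ) + 1)
    - (if ((i : ℕ) : ℤ) + 1 ≤ n then 1 else 0)
  let A : ℤ → K := fun j =>
    HZ d t p (fun i => (L - 1) * uv d 1 i - uv d j i + uv d (j + 1) i + uv d l i) (w j)
  let D : ℤ → K := fun j =>
    HZ d t p (fun i => (L - 1) * uv d 1 i - uv d j i - uv d (j + 1) i + uv d l i) (w j)
  let Bf : ℤ → K := fun j =>
    HZ d t p (fun i => (L - 1) * uv d 1 i + uv d j i - uv d (j + 1) i + uv d l i) (w j)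
  have hA : ∀ j : ℤ, 1 ≤ j → j ≤ l - 2 → A j = D j + A (j + 1) := by
    intro j h1 h2
    have := HZ_peel ht p (j + 1) (by omega) (by omega) 1 le_rfl
      (fun i => (L - 1) * uv d 1 i - uv d j i + uv d (j + 1) i + uv d l i)
      (fun i => (L - 1) * uv d 1 i - uv d j i - uv d (j + 1) i + uv d l i)
      (fun i => (L - 1) * uv d 1 i - uv d (j + 1) i + uv d (j + 1 + 1) i + uv d l i) (w j) (w (j + 1))
      (by intro i hi; simp only [uv]; split_ifs <;> omega)
      (by intro i; ring) (by intro i; rw [add_sub_cancel_right]; ring)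
      (by intro i; simp only [w, uv]; split_ifs <;> omega)
    rw [sub_self, mul_zero, zpow_zero, one_mul] at this
    exact this
  have hB2 : ∀ j : ℤ, 2 ≤ j → j ≤ l - 1 → Bf j = D j + Bf (j - 1) := by
    intro j h1 h2
    have := HZ_peel ht p j (by omega) (by omega) 1 le_rfl
      (fun i => (L - 1) * uv d 1 i + uv d j i - uv d (j + 1) i + uv d l i)
      (fun i => (L - 1) * uv d 1 i - uv d j i - uv d (j + 1) i + uv d l i)
      (fun i => (L - 1) * uv d 1 i + uv d (j - 1) i - uv d (j - 1 + 1) i + uv d l i) (w j) (w (j - 1))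
      (by intro i hi; simp only [uv]; split_ifs <;> omega)
      (by intro i; ring) (by intro i; rw [sub_add_cancel]; ring)
      (by intro i; simp only [w, uv]; split_ifs <;> omega)
    rw [sub_self, mul_zero, zpow_zero, one_mul] at this
    exact this
  have hB1 : Bf 1 = D 1 + t ^ (2 * (L - 1)) * FZ d t p (L - 2) l := by
    exact HZ_peel ht p 1 (by omega) (by omega) L hL
      (fun i => (L - 1) * uv d 1 i + uv d 1 i - uv d (1 + 1) i + uv d l i)
      (fun i => (L - 1) * uv d 1 i - uv d 1 i - uv d (1 + 1) i + uv d l i)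
      (fun i => (L - 2) * uv d 1 i + uv d l i) (w 1) _
      (by intro i hi; simp only [uv]; split_ifs <;> omega)
      (by intro i; ring) (by intro i; simp only [uv]; split_ifs <;> omega)
      (by intro i; simp only [w, uv]; split_ifs <;> omega)
  have hF : FZ d t p L l = FZ d t p (L - 2) l + t ^ (2 * (L - 1)) * A 1 := by
    exact HZ_peel ht p 1 (by omega) (by omega) L hL
      (fun i => L * uv d 1 i + uv d l i)
      (fun i => (L - 2) * uv d 1 i + uv d l i)
      (fun i => (L - 1) * uv d 1 i - uv d 1 i + uv d (1 + 1) i + uv d l i) _ (w 1)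
      (by intro i hi; simp only [uv]; split_ifs <;> omega)
      (by intro i; ring) (by intro i; simp only [uv]; split_ifs <;> omega)
      (by intro i; simp only [w, uv]; split_ifs <;> omega)
  have hBl : Bf (l - 1) = FZ d t p (L - 1) (l - 1) := by
    apply HZ_congr
    · intro i; rw [sub_add_cancel]; ring
    · intro i; simp only [w]; split_ifs <;> omega
  have hAl : A (l - 1) = D (l - 1) + t ^ 2 * (if l ≤ d then FZ d t p (L - 1) (l + 1) else 0) := by
    by_cases hld : l ≤ d
    · rw [if_pos hld]
      have := HZ_peel ht p l (by omega) (by omega) 2 (by omega)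
        (fun i => (L - 1) * uv d 1 i - uv d (l - 1) i + uv d (l - 1 + 1) i + uv d l i)
        (fun i => (L - 1) * uv d 1 i - uv d (l - 1) i - uv d (l - 1 + 1) i + uv d l i)
        (fun i => (L - 1) * uv d 1 i + uv d (l + 1) i) (w (l - 1))
        (fun i => max p (((i : ℕ) : ℤ) + 1) + max (l + 1) (((i : ℕ) : ℤ) + 1))
        (by intro i hi; simp only [uv]; split_ifs <;> omega)
        (by intro i; rw [sub_add_cancel]; ring) (by intro i; rw [sub_add_cancel]; ring)
        (by intro i; simp only [w, uv]; split_ifs <;> omega)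
      rw [show (2 * (2 - 1) : ℤ) = ((2 : ℕ) : ℤ) by norm_num, zpow_natCast] at this
      exact this
    · rw [if_neg hld, mul_zero, add_zero]
      apply HZ_congr
      · intro i; have := i.2; simp only [uv]; split_ifs <;> omega
      · intro i; simp
  -- telescoping
  have key : ∀ n : ℕ, (n : ℤ) + 2 ≤ l →
      A (n + 1) + (if n = 0 then t ^ (2 * (L - 1)) * FZ d t p (L - 2) l else Bf n)
        = A 1 + t ^ (2 * (L - 1)) * FZ d t p (L - 2) l := by
    intro n
    induction n with
    | zero => intro _; simp
    | succ n ih =>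
      intro hn
      push_cast at hn
      rw [← ih (by omega), hA (n + 1) (by omega) (by omega)]
      push_cast
      split_ifs with h0
      · subst h0
        simp only [Nat.cast_zero, zero_add]
        rw [hB1]; ring
      · rw [hB2 (n + 1) (by omega) (by omega), add_sub_cancel_right]; ring
  have kl := key (l - 2).toNat (by omega)
  have e1 : (((l - 2).toNat : ℕ) : ℤ) = l - 2 := by omega
  rw [e1, show l - 2 + 1 = l - 1 by ring, hAl] at kl
  have hlast : D (l - 1) + (if (l - 2).toNat = 0 then t ^ (2 * (L - 1)) * FZ d t p (L - 2) l
      else Bf (l - 2)) = FZ d t p (L - 1) (l - 1) := by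
    rw [← hBl]
    split_ifs with h0
    · have : l = 2 := by omega
      subst this
      rw [show (2 : ℤ) - 1 = 1 by norm_num, hB1]
    · rw [hB2 (l - 1) (by omega) (by omega), show l - 1 - 1 = l - 2 by ring]
  have e2 : t ^ (2 * L) = t ^ (2 * (L - 1)) * t ^ 2 := by
    rw [← zpow_natCast, ← zpow_add₀ ht.1]; congr 1; push_cast; ring
  have e3 : t ^ (4 * (L - 1)) = t ^ (2 * (L - 1)) * t ^ (2 * (L - 1)) := by
    rw [← zpow_add₀ ht.1]; congr 1; ring
  rw [hF, e2, e3]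
  linear_combination t ^ (2 * (L - 1)) * (hlast - kl)

lemma slope_core (d : ℕ) (p l : ℤ) (hp : 0 ≤ p) (hp' : p ≤ d + 1) (hl : 0 ≤ l) (hl' : l ≤ d + 1)
    (hpl : (p + l) % 2 = 0) (M : ℤ → ℤ) (M0 : M 0 = 0) (Md : M (d + 1) = 0)
    (Mpos : ∀ s, 0 ≤ M s)
    (Mpar : 1 ≤ d → (M 1 - (max p 1 + max l 1)) % 2 = 0)
    (Mev : ∀ s : ℤ, 1 ≤ s → s ≤ d →
      (M (s - 1) + M (s + 1) + (if s = l then 1 else 0) + (if s = p then 1 else 0)) % 2 = 0)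
    (Mcon : ∀ s : ℤ, 1 ≤ s → s ≤ d →
      2 * M s ≤ M (s - 1) + M (s + 1) + (if s = l then 1 else 0) + (if s = p then 1 else 0)) :
    p = l ∧ ∀ s : ℤ, 0 ≤ s → s ≤ d + 1 → M s = 0 := by
  let T : ℤ → ℤ := fun s => M (s + 1) - M s + (if l ≤ s then 1 else 0) + (if p ≤ s then 1 else 0)
  have hT : ∀ s, T s = M (s + 1) - M s + (if l ≤ s then 1 else 0) + (if p ≤ s then 1 else 0) :=
    fun s => rfl
  have T0 : T 0 % 2 = 0 := by
    rw [hT, M0, zero_add]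
    rcases Nat.eq_zero_or_pos d with h | h
    · subst h
      simp only [Nat.cast_zero, zero_add] at *
      rw [Md]
      split_ifs <;> omega
    · have := Mpar h
      split_ifs <;> omega
  have Tstep : ∀ s : ℤ, 1 ≤ s → s ≤ d → T (s - 1) ≤ T s ∧ (T s - T (s - 1)) % 2 = 0 := by
    intro s h1 h2
    have a1 := Mev s h1 h2
    have a2 := Mcon s h1 h2
    rw [hT, hT, sub_add_cancel]
    constructor <;> split_ifs at * <;> omega
  have Tev : ∀ n : ℕ, n ≤ d → T n % 2 = 0 := by
    intro n
    induction n with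
    | zero => intro _; simpa using T0
    | succ n ih =>
      intro hn
      have := ih (by omega)
      have h2 := (Tstep (n + 1) (by omega) (by omega)).2
      rw [add_sub_cancel_right] at h2
      push_cast; omega
  have Tmono : ∀ (s : ℕ) (n : ℕ), s + n ≤ d → T s ≤ T ((s : ℤ) + n) := by
    intro s n
    induction n with
    | zero => intro _; simp
    | succ n ih =>
      intro hn
      have := ih (by omega)
      have h2 := (Tstep (s + n + 1) (by omega) (by omega)).1
      rw [add_sub_cancel_right] at h2
      push_cast
      rw [← add_assoc]; omega
  have T0pos : 0 ≤ T 0 := by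
    have := Mpos 1
    rw [hT, M0, zero_add]
    split_ifs <;> omega
  have Tpos : ∀ n : ℕ, n ≤ d → 0 ≤ T n := by
    intro n hn
    have := Tmono 0 n (by omega)
    simp only [Nat.cast_zero, zero_add] at this
    omega
  have main : ∀ n : ℕ, n ≤ d + 1 →
      ((∀ s : ℤ, 0 ≤ s → s ≤ n → M s = 0) ∧ (n : ℤ) ≤ p ∧ (n : ℤ) ≤ l) ∨
      (p = l ∧ ∀ s : ℤ, 0 ≤ s → s ≤ d + 1 → M s = 0) := by
    intro n
    induction n with
    | zero =>
      intro _
      left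
      refine ⟨fun s h1 h2 => ?_, by simpa using hp, by simpa using hl⟩
      have : s = 0 := by push_cast at h2; omega
      rw [this, M0]
    | succ n ih =>
      intro hn
      rcases ih (by omega) with h | h
      swap
      · exact Or.inr h
      obtain ⟨h1, h2, h3⟩ := h
      have hMn := h1 n (by omega) le_rfl
      by_cases hTn : T n = 0
      · left
        rw [hT, hMn] at hTn
        have hp1 := Mpos (n + 1)
        have q : M (n + 1) = 0 ∧ ¬ (l ≤ n) ∧ ¬ (p ≤ n) := by
          split_ifs at hTn <;> omega
        refine ⟨?_, by push_cast; omega, by push_cast; omega⟩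
        intro s hs1 hs2
        push_cast at hs2
        rcases eq_or_lt_of_le hs2 with h | h
        · rw [h]; exact q.1
        · exact h1 s hs1 (by omega)
      · right
        have t2 : 2 ≤ T n := by
          have := Tev n (by omega)
          have := Tpos n (by omega)
          omega
        have mm : ∀ k : ℕ, n + k ≤ d → M ((n : ℤ) + k) ≤ M ((n : ℤ) + k + 1) := by
          intro k hk
          have := Tmono n k hk
          have h5 := hT ((n : ℤ) + k)
          split_ifs at h5 <;> omega
        have back : ∀ k : ℕ, n + k ≤ d + 1 → M ((d : ℤ) + 1 - k) = 0 := by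
          intro k
          induction k with
          | zero => intro _; simpa using Md
          | succ k ihk =>
            intro hk
            have a1 := ihk (by omega)
            have a2 := mm (d - n - k) (by omega)
            have e1 : (n : ℤ) + ((d - n - k : ℕ) : ℤ) = (d : ℤ) + 1 - ((k + 1 : ℕ) : ℤ) := by
              push_cast; omega
            have e2 : (d : ℤ) + 1 - ((k + 1 : ℕ) : ℤ) + 1 = (d : ℤ) + 1 - k := by push_cast; ring
            rw [e1, e2, a1] at a2
            have := Mpos ((d : ℤ) + 1 - ((k + 1 : ℕ) : ℤ))
            omega
        have all : ∀ s : ℤ, 0 ≤ s → s ≤ d + 1 → M s = 0 := by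
          intro s hs1 hs2
          by_cases hs : s ≤ n
          · exact h1 s hs1 hs
          · have := back ((d : ℤ) + 1 - s).toNat (by omega)
            rwa [show (d : ℤ) + 1 - ((((d : ℤ) + 1 - s).toNat : ℕ) : ℤ) = s by omega] at this
        refine ⟨?_, all⟩
        have h5 := hT n
        rw [hMn, all (n + 1) (by omega) (by omega)] at h5
        split_ifs at h5 <;> omega
  rcases main (d + 1) le_rfl with h | h
  · obtain ⟨h1, h2, h3⟩ := h
    push_cast at h1 h2 h3
    exact ⟨by omega, h1⟩
  · exact h

lemma at'_nonneg (d : ℕ) (f : Fin d → ℤ) (h : ∀ i, 0 ≤ f i) (s : ℤ) : 0 ≤ at' d f s := by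
  unfold at'
  apply Finset.sum_nonneg
  intro i _
  apply mul_nonneg _ (h i)
  unfold uv; split_ifs <;> simp

lemma gauss_zero_right {t : K} (ht : Good t) (N : ℤ) (hN : 0 ≤ N) : gauss t N 0 = 1 := by
  have := qp_ne ht N.toNat
  simp [gauss, hN, qp_zero, this]

lemma FZ_init {t : K} (ht : Good t) {d : ℕ} (p l : ℤ) (hp : 0 ≤ p) (hp' : p ≤ d + 1) (hl : 0 ≤ l)
    (hl' : l ≤ d + 1) (hpl : (p + l) % 2 = 0) :
    FZ d t p 0 l = if l = p then 1 else 0 := by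
  unfold FZ HZ GZ
  have key : ∀ m : Fin d → ℤ, TZ d t (fun i => 0 * uv d 1 i + uv d l i + uv d p i) (uv d p)
      (fun i => max p (((i : ℕ) : ℤ) + 1) + max l (((i : ℕ) : ℤ) + 1)) m ≠ 0 → p = l ∧ m = 0 := by
    intro m hm
    obtain ⟨h1, h2⟩ := TZ_ne hm
    have hs : ∀ s : ℤ, 1 ≤ s → s ≤ d →
      (at' d m (s - 1) + at' d m (s + 1) + (if s = l then 1 else 0) + (if s = p then 1 else 0)) % 2 = 0
      ∧ 2 * at' d m s ≤ at' d m (s - 1) + at' d m (s + 1) + (if s = l then 1 else 0)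
        + (if s = p then 1 else 0) := by
      intro s hs1 hs2
      have hi : ((s - 1).toNat : ℤ) = s - 1 := by omega
      have := h2 ⟨(s - 1).toNat, by omega⟩
      unfold topZ at this
      rw [sum_inc] at this
      rw [at'_val d m ⟨(s - 1).toNat, by omega⟩ s (by simp; omega)]
      simp only [uv, hi] at this
      rw [show s - 1 + 2 = s + 1 by ring, show s - 1 + 1 = s by ring] at this
      obtain ⟨c1, c2, c3⟩ := this
      constructor
      · split_ifs at * <;> omega
      · split_ifs at * <;> omega
    have := slope_core d p l hp hp' hl hl' hpl (at' d m) (at'_out d m 0 (by omega))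
      (at'_out d m _ (by omega)) (at'_nonneg d m fun i => (h2 i).2.1)
      (by
        intro hd
        rw [at'_val d m ⟨0, hd⟩ 1 (by simp)]
        have := h1 ⟨0, hd⟩
        simpa using this)
      (fun s a b => (hs s a b).1) (fun s a b => (hs s a b).2)
    refine ⟨this.1, ?_⟩
    funext i
    have h3 := this.2 ((i : ℕ) + 1) (by omega) (by omega)
    rw [at'_val d m i _ rfl] at h3
    exact h3
  by_cases h : l = p
  · rw [if_pos h, finsum_eq_single _ 0]
    · subst h
      unfold TZ
      rw [if_pos]
      · have : ∀ i, gaussHalf t (topZ d (fun i => 0 * uv d 1 i + uv d l i + uv d l i) 0 i) 0 = 1 := by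
          intro i
          have e : topZ d (fun i => 0 * uv d 1 i + uv d l i + uv d l i) 0 i = 2 * uv d l i := by
            simp [topZ]; ring
          have h0 : 0 ≤ uv d l i := by unfold uv; split_ifs <;> simp
          rw [e]
          unfold gaussHalf
          rw [if_pos (by omega), gauss_zero_right ht _ (by omega)]
        simp only [Pi.zero_apply, this]
        simp [quadZ]
      · intro i
        simp only [Pi.zero_apply]
        omega
    · intro m hm
      by_contra hne
      exact hm (key m hne).2
  · rw [if_neg h]
    apply finsum_eq_zero_of_forall_eq_zero
    intro m
    by_contra hne
    exact h (key m hne).1.symm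

def VV (t : K) (L x : ℤ) : K := t ^ (x ^ 2 - x) * gauss t L ((L + x) / 2)

lemma VV_rec {t : K} (ht : Good t) (L x : ℤ) (hL : 1 ≤ L) (hp : (L + x) % 2 = 0) :
    VV t L x = t ^ (2 * L) * VV t (L - 1) (x + 1) + t ^ (2 * (L - 1)) * VV t (L - 1) (x - 1)
      + (1 - t ^ (4 * (L - 1))) * VV t (L - 2) x := by
  obtain ⟨k, hk⟩ : ∃ k, L + x = 2 * k := ⟨(L + x) / 2, by omega⟩
  have hx : x = 2 * k - L := by omega
  have e1 : (L + x) / 2 = k := by omega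
  have e2 : (L - 1 + (x + 1)) / 2 = k := by omega
  have e3 : (L - 1 + (x - 1)) / 2 = k - 1 := by omega
  have e4 : (L - 2 + x) / 2 = k - 1 := by omega
  unfold VV
  rw [e1, e2, e3, e4]
  have f1 : t ^ (2 * L) * (t ^ ((x + 1) ^ 2 - (x + 1)) * gauss t (L - 1) k)
      = t ^ (x ^ 2 - x) * (t ^ (4 * k) * gauss t (L - 1) k) := by
    rw [← mul_assoc, ← mul_assoc, ← zpow_add₀ ht.1, ← zpow_add₀ ht.1]
    congr 2; rw [hx]; ring
  have f2 : t ^ (2 * (L - 1)) * (t ^ ((x - 1) ^ 2 - (x - 1)) * gauss t (L - 1) (k - 1))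
      = t ^ (x ^ 2 - x) * (t ^ (4 * (L - k)) * gauss t (L - 1) (k - 1)) := by
    rw [← mul_assoc, ← mul_assoc, ← zpow_add₀ ht.1, ← zpow_add₀ ht.1]
    congr 2; rw [hx]; ring
  rw [f1, f2]
  rcases eq_or_lt_of_le hL with h | h
  · subst h
    rw [gauss_three_one ht]
    simp
    ring
  · rw [gauss_three ht (by omega)]
    ring

lemma VV_pascal {t : K} (ht : Good t) (L x : ℤ) (hL : L ≠ 0) (hp : (L + x) % 2 = 0) :
    VV t L x = t ^ (2 * L) * VV t (L - 1) (x + 1)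
      + t ^ (x ^ 2 - x) * gauss t (L - 1) ((L + x) / 2 - 1) := by
  obtain ⟨k, hk⟩ : ∃ k, L + x = 2 * k := ⟨(L + x) / 2, by omega⟩
  have hx : x = 2 * k - L := by omega
  have e1 : (L + x) / 2 = k := by omega
  have e2 : (L - 1 + (x + 1)) / 2 = k := by omega
  unfold VV
  rw [e1, e2]
  have f1 : t ^ (2 * L) * (t ^ ((x + 1) ^ 2 - (x + 1)) * gauss t (L - 1) k)
      = t ^ (x ^ 2 - x) * (t ^ (4 * k) * gauss t (L - 1) k) := by
    rw [← mul_assoc, ← mul_assoc, ← zpow_add₀ ht.1, ← zpow_add₀ ht.1]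
    congr 2; rw [hx]; ring
  rw [f1, ← gauss_pascal' ht hL]
  ring

lemma gauss_ne {t : K} {N m : ℤ} (h : gauss t N m ≠ 0) : 0 ≤ m ∧ m ≤ N := by
  unfold gauss at h
  by_contra h'
  simp [h'] at h

lemma fin_abs (r c B : ℤ) (hr : 1 ≤ r) : {j : ℤ | |c + r * j| ≤ B}.Finite := by
  apply (Set.finite_Icc (-(|c| + B)) (|c| + B)).subset
  intro j hj
  simp only [Set.mem_ofPred_eq] at hj
  have h1 : |r * j| ≤ |c| + B := by
    calc |r * j| = |(c + r * j) - c| := by ring_nf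
      _ ≤ |c + r * j| + |c| := abs_sub _ _
      _ ≤ |c| + B := by linarith
  have h2 : |j| ≤ |r * j| := by
    rw [abs_mul, abs_of_pos (by omega : 0 < r)]
    nlinarith [abs_nonneg j]
  have := abs_le.1 (h2.trans h1)
  exact ⟨this.1, this.2⟩

lemma fin_of_gauss {t : K} (r c L e : ℤ) (hr : 1 ≤ r) (f g : ℤ → K) (s : ℤ → ℤ) (N : ℤ)
    (hs : ∀ j, s j = c + 2 * r * j ∨ s j = c - 2 * r * j)
    (h : ∀ j, f j = g j * gauss t N ((L + s j) / 2 + e)) : Function.HasFiniteSupport f := by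
  have key : ∀ j, f j ≠ 0 → |s j| ≤ 2 * (|N| + |e|) + |L| + 1 := by
    intro j hj
    rw [h] at hj
    have := gauss_ne (right_ne_zero_of_mul hj)
    rw [abs_le]
    have := le_abs_self N
    have := le_abs_self e
    have := neg_abs_le e
    have := le_abs_self L
    have := neg_abs_le L
    constructor <;> omega
  apply ((fin_abs (2 * r) c (2 * (|N| + |e|) + |L| + 1) (by omega)).union
    (fin_abs (2 * r) (-c) (2 * (|N| + |e|) + |L| + 1) (by omega))).subset
  intro j hj
  have := key j hj
  rcases hs j with h' | h'
  · left; simpa [h'] using this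
  · right
    simp only [Set.mem_ofPred_eq]
    rw [h', ← abs_neg] at this
    rwa [show -c + 2 * r * j = -(c - 2 * r * j) by ring]

def YA (t : K) (r a L b : ℤ) : K :=
  ∑ᶠ j : ℤ, t ^ (-(4 * r * j ^ 2 + 4 * j * a - 2 * r * j)) * VV t L (a + 2 * r * j - b)

def YB (t : K) (r a L b : ℤ) : K :=
  ∑ᶠ j : ℤ, t ^ (-(4 * r * j ^ 2 + 4 * j * a + 2 * a + 2 * r * j)) * VV t L (-(a + 2 * r * j) - b)

def YY (t : K) (r a L b : ℤ) : K := YA t r a L b - YB t r a L b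

lemma finA {t : K} {r : ℤ} (hr : 1 ≤ r) (c L : ℤ) (g : ℤ → K) :
    Function.HasFiniteSupport (fun j : ℤ => g j * VV t L (c + 2 * r * j)) :=
  fin_of_gauss (t := t) r c L 0 hr _ (fun j => g j * t ^ ((c + 2 * r * j) ^ 2 - (c + 2 * r * j)))
    (fun j => c + 2 * r * j) L (fun j => Or.inl rfl) (fun j => by rw [VV, add_zero]; ring)

lemma finB {t : K} {r : ℤ} (hr : 1 ≤ r) (c L : ℤ) (g : ℤ → K) :
    Function.HasFiniteSupport (fun j : ℤ => g j * VV t L (c - 2 * r * j)) :=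
  fin_of_gauss (t := t) r c L 0 hr _ (fun j => g j * t ^ ((c - 2 * r * j) ^ 2 - (c - 2 * r * j)))
    (fun j => c - 2 * r * j) L (fun j => Or.inr rfl) (fun j => by rw [VV, add_zero]; ring)

lemma finA' {t : K} {r : ℤ} (hr : 1 ≤ r) (a b L : ℤ) (g : ℤ → K) :
    Function.HasFiniteSupport (fun j : ℤ => g j * VV t L (a + 2 * r * j - b)) := by
  have := finA (t := t) hr (a - b) L g
  convert this using 4; ring

lemma finB' {t : K} {r : ℤ} (hr : 1 ≤ r) (a b L : ℤ) (g : ℤ → K) :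
    Function.HasFiniteSupport (fun j : ℤ => g j * VV t L (-(a + 2 * r * j) - b)) := by
  have := finB (t := t) hr (-a - b) L g
  convert this using 4; ring

lemma hfs_mul {f : ℤ → K} (c : K) (h : Function.HasFiniteSupport f) :
    Function.HasFiniteSupport (fun j => c * f j) :=
  Set.Finite.subset h fun j hj => right_ne_zero_of_mul hj

lemma hfs_add {f g : ℤ → K} (h : Function.HasFiniteSupport f) (h' : Function.HasFiniteSupport g) :
    Function.HasFiniteSupport (fun j => f j + g j) :=
  (Set.Finite.union h h').subset (Function.support_add f g)

lemma YY_rec {t : K} (ht : Good t) {r : ℤ} (hr : 1 ≤ r) (a L b : ℤ) (hL : 1 ≤ L)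
    (hp : (L + a + b) % 2 = 0) :
    YY t r a L b = t ^ (2 * L) * YY t r a (L - 1) (b - 1) + t ^ (2 * (L - 1)) * YY t r a (L - 1) (b + 1)
      + (1 - t ^ (4 * (L - 1))) * YY t r a (L - 2) b := by
  have hA : YA t r a L b = t ^ (2 * L) * YA t r a (L - 1) (b - 1)
      + t ^ (2 * (L - 1)) * YA t r a (L - 1) (b + 1) + (1 - t ^ (4 * (L - 1))) * YA t r a (L - 2) b := by
    unfold YA
    rw [mul_finsum, mul_finsum, mul_finsum, ← finsum_add_distrib, ← finsum_add_distrib]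
    · refine finsum_congr fun j => ?_
      have e : (L + (a + 2 * r * j - b)) % 2 = 0 := by
        have : L + (a + 2 * r * j - b) = (L + a + b) + 2 * (r * j - b) := by ring
        omega
      rw [VV_rec ht L _ hL e, show a + 2 * r * j - (b - 1) = a + 2 * r * j - b + 1 by ring,
        show a + 2 * r * j - (b + 1) = a + 2 * r * j - b - 1 by ring]
      ring
    · exact hfs_add (hfs_mul _ (finA' hr a _ _ _)) (hfs_mul _ (finA' hr a _ _ _))
    · exact hfs_mul _ (finA' hr a _ _ _)
    · exact hfs_mul _ (finA' hr a _ _ _)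
    · exact hfs_mul _ (finA' hr a _ _ _)
  have hB : YB t r a L b = t ^ (2 * L) * YB t r a (L - 1) (b - 1)
      + t ^ (2 * (L - 1)) * YB t r a (L - 1) (b + 1) + (1 - t ^ (4 * (L - 1))) * YB t r a (L - 2) b := by
    unfold YB
    rw [mul_finsum, mul_finsum, mul_finsum, ← finsum_add_distrib, ← finsum_add_distrib]
    · refine finsum_congr fun j => ?_
      have e : (L + (-(a + 2 * r * j) - b)) % 2 = 0 := by
        have : L + (-(a + 2 * r * j) - b) = (L + a + b) + 2 * (-(r * j) - b - a) := by ring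
        omega
      rw [VV_rec ht L _ hL e, show -(a + 2 * r * j) - (b - 1) = -(a + 2 * r * j) - b + 1 by ring,
        show -(a + 2 * r * j) - (b + 1) = -(a + 2 * r * j) - b - 1 by ring]
      ring
    · exact hfs_add (hfs_mul _ (finB' hr a _ _ _)) (hfs_mul _ (finB' hr a _ _ _))
    · exact hfs_mul _ (finB' hr a _ _ _)
    · exact hfs_mul _ (finB' hr a _ _ _)
    · exact hfs_mul _ (finB' hr a _ _ _)
  unfold YY
  rw [hA, hB]; ring

lemma YY_zero {t : K} (ht : Good t) {r : ℤ} (a L : ℤ) (hp : (L + a) % 2 = 0) :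
    YY t r a L 0 = 0 := by
  unfold YY YA YB
  rw [sub_eq_zero]
  refine finsum_congr fun j => ?_
  unfold VV
  have e : (L + (-(a + 2 * r * j) - 0)) / 2 = L - (L + (a + 2 * r * j - 0)) / 2 := by
    have : 2 * r * j = 2 * (r * j) := by ring
    omega
  rw [e, gauss_symm, ← mul_assoc, ← mul_assoc, ← zpow_add₀ ht.1, ← zpow_add₀ ht.1]
  congr 2; ring

lemma YY_top {t : K} (ht : Good t) {r : ℤ} (hr : 1 ≤ r) (a L : ℤ) (hL : L ≠ 0)
    (hp : (L + a + (r - 1)) % 2 = 0) :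
    YY t r a L (r - 1) = t ^ (2 * L) * YY t r a (L - 1) (r - 2) := by
  let x : ℤ → ℤ := fun j => a + 2 * r * j - (r - 1)
  let x' : ℤ → ℤ := fun j => -(a + 2 * r * j) - (r - 1)
  let gA : ℤ → K := fun j => t ^ (-(4 * r * j ^ 2 + 4 * j * a - 2 * r * j)) *
    (t ^ ((x j) ^ 2 - x j) * gauss t (L - 1) ((L + x j) / 2 - 1))
  let gB : ℤ → K := fun j => t ^ (-(4 * r * j ^ 2 + 4 * j * a + 2 * a + 2 * r * j)) *
    (t ^ ((x' j) ^ 2 - x' j) * gauss t (L - 1) ((L + x' j) / 2 - 1))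
  have par : ∀ j, (L + x j) % 2 = 0 := by
    intro j
    have : L + x j = (L + a + (r - 1)) + 2 * (r * j - (r - 1)) := by simp only [x]; ring
    omega
  have par' : ∀ j, (L + x' j) % 2 = 0 := by
    intro j
    have : L + x' j = (L + a + (r - 1)) + 2 * (-(r * j) - (r - 1) - a) := by simp only [x']; ring
    omega
  have fA : Function.HasFiniteSupport gA :=
    fin_of_gauss (t := t) r (a - (r - 1)) L (-1) hr _
      (fun j => t ^ (-(4 * r * j ^ 2 + 4 * j * a - 2 * r * j)) * t ^ ((x j) ^ 2 - x j)) x (L - 1)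
      (fun j => Or.inl (by simp only [x]; ring)) (fun j => by simp only [gA, ← sub_eq_add_neg]; ring)
  have fB : Function.HasFiniteSupport gB :=
    fin_of_gauss (t := t) r (-a - (r - 1)) L (-1) hr _
      (fun j => t ^ (-(4 * r * j ^ 2 + 4 * j * a + 2 * a + 2 * r * j)) * t ^ ((x' j) ^ 2 - x' j)) x'
      (L - 1)
      (fun j => Or.inr (by simp only [x']; ring)) (fun j => by simp only [gB, ← sub_eq_add_neg]; ring)
  have hA : YA t r a L (r - 1) = t ^ (2 * L) * YA t r a (L - 1) (r - 2) + ∑ᶠ j, gA j := by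
    unfold YA
    rw [mul_finsum, ← finsum_add_distrib _ fA]
    · refine finsum_congr fun j => ?_
      have := VV_pascal ht L (x j) hL (par j)
      rw [show a + 2 * r * j - (r - 2) = x j + 1 by simp only [x]; ring]
      simp only [gA]
      change _ * VV t L (x j) = _
      rw [this]; ring
    · exact hfs_mul _ (finA' hr a _ _ _)
  have hB : YB t r a L (r - 1) = t ^ (2 * L) * YB t r a (L - 1) (r - 2) + ∑ᶠ j, gB j := by
    unfold YB
    rw [mul_finsum, ← finsum_add_distrib _ fB]
    · refine finsum_congr fun j => ?_
      have := VV_pascal ht L (x' j) hL (par' j)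
      rw [show -(a + 2 * r * j) - (r - 2) = x' j + 1 by simp only [x']; ring]
      simp only [gB]
      change _ * VV t L (x' j) = _
      rw [this]; ring
    · exact hfs_mul _ (finB' hr a _ _ _)
  have hAB : ∑ᶠ j, gA j = ∑ᶠ j, gB j := by
    rw [← finsum_comp_equiv (Equiv.subRight (1 : ℤ)) (f := gB)]
    refine finsum_congr fun j => ?_
    have hx : x' (j - 1) = 2 - x j := by simp only [x, x']; ring
    simp only [Equiv.subRight_apply, gA, gB]
    have e : (L + x' (j - 1)) / 2 - 1 = (L - 1) - ((L + x j) / 2 - 1) := by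
      have := par j
      rw [hx]; omega
    rw [e, gauss_symm, ← mul_assoc, ← mul_assoc, ← zpow_add₀ ht.1, ← zpow_add₀ ht.1, hx]
    congr 2; simp only [x]; ring
  unfold YY
  rw [hA, hB, hAB]; ring

lemma gauss_zero_left (t : K) (m : ℤ) : gauss t 0 m = if m = 0 then 1 else 0 := by
  unfold gauss
  by_cases h : m = 0
  · subst h; simp [qp_zero]
  · rw [if_neg (by omega), if_neg h]

lemma YY_init {t : K} {r : ℤ} (a b : ℤ) (ha : 1 ≤ a) (ha' : a ≤ r - 1) (hb : 1 ≤ b)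
    (hb' : b ≤ r - 1) (hp : (a + b) % 2 = 0) :
    YY t r a 0 b = if a = b then 1 else 0 := by
  have hB : YB t r a 0 b = 0 := by
    unfold YB
    apply finsum_eq_zero_of_forall_eq_zero
    intro j
    unfold VV
    rw [gauss_zero_left, if_neg]
    · simp
    · intro h
      have h2 : a + b + 2 * (r * j) = 0 := by
        have : 2 * r * j = 2 * (r * j) := by ring
        omega
      rcases lt_trichotomy j 0 with hj | hj | hj
      · nlinarith
      · subst hj; simp at h2; omega
      · nlinarith
  have h0 : ∀ j : ℤ, j ≠ 0 → VV t 0 (a + 2 * r * j - b) = 0 := by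
    intro j hj
    unfold VV
    rw [gauss_zero_left, if_neg]
    · simp
    · intro h
      have h2 : a - b + 2 * (r * j) = 0 := by
        have : 2 * r * j = 2 * (r * j) := by ring
        omega
      rcases lt_or_gt_of_ne hj with hj | hj <;> nlinarith
  unfold YY
  rw [hB, sub_zero]
  unfold YA
  rw [finsum_eq_single _ 0 (fun j hj => by rw [h0 j hj, mul_zero])]
  unfold VV
  rw [gauss_zero_left]
  by_cases h : a = b
  · subst h; simp
  · rw [if_neg h, if_neg]
    · simp
    · intro h'
      simp at h'
      omega

/-- Melzer's identity in recursive form. -/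
lemma YY_eq_FZ {t : K} (ht : Good t) (d : ℕ) (a : ℤ) (ha : 1 ≤ a) (ha' : a ≤ d + 2) (L : ℕ) :
    ∀ b : ℤ, 1 ≤ b → b ≤ d + 2 → ((L : ℤ) + a + b) % 2 = 0 →
      YY t (d + 3) a L b = (if b = d + 2 then t ^ (2 * (L : ℤ)) else 1)
        * FZ d t (d + 2 - a) L (d + 2 - b) := by
  induction L using Nat.strong_induction_on with
  | _ L ih =>
  intro b hb hb' hp
  rcases Nat.eq_zero_or_pos L with h0 | h0
  · subst h0
    simp only [Nat.cast_zero, zero_add, mul_zero, zpow_zero, ite_self, one_mul] at *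
    rw [YY_init a b ha (by omega) hb (by omega) hp,
      FZ_init ht _ _ (by omega) (by omega) (by omega) (by omega) (by omega)]
    congr 1
    apply propext; omega
  have c1 : ((L - 1 : ℕ) : ℤ) = (L : ℤ) - 1 := by omega
  have ih1 := ih (L - 1) (by omega)
  rw [c1] at ih1
  by_cases hbt : b = d + 2
  · rw [if_pos hbt, hbt, show (d : ℤ) + 2 = (d + 3) - 1 by ring, YY_top ht (by omega) a L (by omega) (by omega),
      ih1 _ (by omega) (by omega) (by omega), if_neg (by omega), one_mul,
      show (d : ℤ) + 3 - 1 - (d + 3 - 1) = 0 by ring, FZ_zero]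
    congr 2 <;> ring
  rw [if_neg hbt, one_mul]
  have h2 : (1 - t ^ (4 * ((L : ℤ) - 1))) * YY t (d + 3) a (L - 2) b
      = (1 - t ^ (4 * ((L : ℤ) - 1))) * FZ d t (d + 2 - a) (L - 2) (d + 2 - b) := by
    rcases Nat.eq_or_lt_of_le h0 with h | h
    · have : (L : ℤ) = 1 := by omega
      simp [this]
    · have c2 : ((L - 2 : ℕ) : ℤ) = (L : ℤ) - 2 := by omega
      have ih2 := ih (L - 2) (by omega) b hb hb' (by omega)
      rw [c2, if_neg hbt, one_mul] at ih2
      rw [ih2]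
  have hlow : YY t (d + 3) a (L - 1) (b - 1) =
      if 2 ≤ b then FZ d t (d + 2 - a) (L - 1) (d + 2 - b + 1) else 0 := by
    split_ifs with h
    · rw [ih1 _ (by omega) (by omega) (by omega), if_neg (by omega), one_mul]
      congr 1; ring
    · rw [show b - 1 = 0 by omega, YY_zero ht a _ (by omega)]
  have hup := ih1 (b + 1) (by omega) (by omega) (by omega)
  rw [YY_rec ht (by omega) a L b (by omega) hp, h2, hlow, hup]
  by_cases hb1 : b = d + 1
  · subst hb1
    rw [if_pos (show (d : ℤ) + 1 + 1 = d + 2 by ring), show (d : ℤ) + 2 - (d + 1 + 1) = 0 by ring,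
      FZ_zero, show (d : ℤ) + 2 - (d + 1) = 1 by ring, show (L : ℤ) - 1 - 1 = L - 2 by ring,
      show (1 : ℤ) + 1 = 2 by norm_num]
    have e : t ^ (4 * ((L : ℤ) - 1)) = t ^ (2 * ((L : ℤ) - 1)) * t ^ (2 * ((L : ℤ) - 1)) := by
      rw [← zpow_add₀ ht.1]; congr 1; ring
    rcases Nat.eq_zero_or_pos d with hd | hd
    · subst hd
      rw [if_neg (show ¬ ((2 : ℤ) ≤ ((0 : ℕ) : ℤ) + 1) by simp),
        FZ_one_of_zero _ (L : ℤ) (L - 2), e]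
      ring
    · rw [if_pos (show (2 : ℤ) ≤ (d : ℤ) + 1 by omega), FZ_one ht hd _ (L : ℤ) (by omega), e]
      ring
  · rw [if_neg (show ¬ (b + 1 = (d : ℤ) + 2) by omega), one_mul,
      FZ_rec ht _ (L : ℤ) _ (by omega) (by omega) (by omega),
      show (d : ℤ) + 2 - (b + 1) = d + 2 - b - 1 by ring]
    by_cases h : 2 ≤ b
    · rw [if_pos h, if_pos (by omega)]
    · rw [if_neg h, if_neg (by omega)]

lemma alg_aux {t : K} (ht : Good t) {Q : K} (hQ : Q ≠ 0) (X : K) {A B C D : ℤ} (h : A + B = C + D) :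
    t ^ A * (t ^ B * (Q * X)) * Q⁻¹ = t ^ C * (t ^ D * X) := by
  have e : t ^ A * t ^ B = t ^ C * t ^ D := by
    rw [← zpow_add₀ ht.1, ← zpow_add₀ ht.1, h]
  field_simp
  linear_combination X * e

/-- Melzer's identity -/
lemma melzer {t : K} (ht : Good t) (d : ℕ) (δ ε : ℤ) (ha : 1 ≤ ε + δ) (ha' : ε + δ ≤ d + 2)
    (hb : 1 ≤ ε - δ) (hb' : ε - δ ≤ d + 1) (n : ℕ) :
    FZ d t (d + 2 - (ε + δ)) (2 * n) (d + 2 - (ε - δ)) * (qp t (2 * n))⁻¹ =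
      t ^ (2 * δ * (2 * δ - 1)) *
      ((∑ᶠ j : ℤ, t ^ (4 * (j * ((d + 3) * (d + 2) * j + (d + 2) * (ε + δ) - (d + 3) * (ε - δ)))) *
          (iq t (n - (δ + (d + 3) * j)) * iq t (n + (δ + (d + 3) * j))))
      - ∑ᶠ j : ℤ, t ^ (4 * ((j * (d + 3) + (ε + δ)) * (j * (d + 2) + (ε - δ)))) *
          (iq t (n - (ε + (d + 3) * j)) * iq t (n + (ε + (d + 3) * j)))) := by
  have hY := YY_eq_FZ ht d (ε + δ) ha ha' (2 * n) (ε - δ) hb (by omega) (by push_cast; omega)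
  rw [if_neg (by omega), one_mul] at hY
  push_cast at hY
  rw [← hY]
  unfold YY YA YB
  have hq := qp_ne ht (2 * n)
  have hg : ∀ s : ℤ, gauss t (2 * (n : ℤ)) (n + s) = qp t (2 * n) * (iq t (n - s) * iq t (n + s)) := by
    intro s
    rw [gauss_eq t (by omega), show 2 * (n : ℤ) - (n + s) = n - s by ring,
      show (2 * (n : ℤ)).toNat = 2 * n by omega, mul_comm (iq t (n - s))]
  have hg' : ∀ s : ℤ, gauss t (2 * (n : ℤ)) (n - s) = qp t (2 * n) * (iq t (n - s) * iq t (n + s)) := by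
    intro s
    rw [sub_eq_add_neg, hg, sub_neg_eq_add, mul_comm (iq t (n + s))]
  rw [mul_sub, sub_mul, mul_finsum, mul_finsum, finsum_mul, finsum_mul]
  congr 1
  · refine finsum_congr fun j => ?_
    unfold VV
    rw [show (2 * (n : ℤ) + (ε + δ + 2 * (d + 3) * j - (ε - δ))) / 2 = n + (δ + (d + 3) * j) by
      have : 2 * ((d : ℤ) + 3) * j = 2 * ((d + 3) * j) := by ring
      omega, hg]
    exact alg_aux ht hq _ (by ring)
  · refine finsum_congr fun j => ?_
    unfold VV
    rw [show (2 * (n : ℤ) + (-(ε + δ + 2 * (d + 3) * j) - (ε - δ))) / 2 = n - (ε + (d + 3) * j) by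
      have : 2 * ((d : ℤ) + 3) * j = 2 * ((d + 3) * j) := by ring
      omega, hg']
    exact alg_aux ht hq _ (by ring)

lemma qvander {t : K} (ht : Good t) (M : ℕ) : ∀ c : ℤ,
    ∑ i ∈ Finset.range (M + 1), t ^ (4 * ((i : ℤ) * (i + c))) * gauss t M i * iq t (i + c)
      = iq t (M + c) := by
  induction M with
  | zero => intro c; simp [gauss_zero_left]
  | succ M ih =>
    intro c
    have hs : ∀ i : ℕ, t ^ (4 * ((i : ℤ) * (i + c))) * gauss t ((M + 1 : ℕ) : ℤ) i * iq t (i + c)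
        = t ^ (4 * ((i : ℤ) * (i + c))) * gauss t M i * iq t (i + c)
        + t ^ (4 * ((i : ℤ) * (i + c))) * (t ^ (4 * ((M : ℤ) + 1 - i)) * gauss t M (i - 1)) * iq t (i + c) := by
      intro i
      rw [gauss_pascal ht (by omega)]
      push_cast
      rw [add_sub_cancel_right]; ring
    rw [Finset.sum_congr rfl fun i _ => hs i, Finset.sum_add_distrib]
    rw [Finset.sum_range_succ, ih c]
    have z1 : gauss t (M : ℤ) ((M + 1 : ℕ) : ℤ) = 0 := by
      unfold gauss; rw [if_neg]; push_cast; omega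
    rw [z1, Finset.sum_range_succ']
    have z2 : gauss t (M : ℤ) (((0 : ℕ) : ℤ) - 1) = 0 := gauss_neg_right t _ (by simp)
    rw [z2]
    have h2 : ∀ i : ℕ, t ^ (4 * (((i + 1 : ℕ) : ℤ) * (((i + 1 : ℕ) : ℤ) + c))) *
        (t ^ (4 * ((M : ℤ) + 1 - ((i + 1 : ℕ) : ℤ))) * gauss t M (((i + 1 : ℕ) : ℤ) - 1))
          * iq t (((i + 1 : ℕ) : ℤ) + c)
        = t ^ (4 * (M + 1 + c)) * (t ^ (4 * ((i : ℤ) * (i + (c + 1)))) * gauss t M i * iq t (i + (c + 1))) := by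
      intro i
      push_cast
      rw [add_sub_cancel_right, show (i : ℤ) + 1 + c = i + (c + 1) by ring]
      have : t ^ (4 * (((i : ℤ) + 1) * (i + (c + 1)))) * t ^ (4 * ((M : ℤ) + 1 - (i + 1)))
        = t ^ (4 * ((M : ℤ) + 1 + c)) * t ^ (4 * ((i : ℤ) * (i + (c + 1)))) := by
        rw [← zpow_add₀ ht.1, ← zpow_add₀ ht.1]; congr 1; ring
      linear_combination (gauss t M i * iq t (i + (c + 1))) * this
    rw [Finset.sum_congr rfl fun i _ => h2 i, ← Finset.mul_sum, ih (c + 1)]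
    have := iq_pred ht ((M : ℤ) + 1 + c)
    rw [show (M : ℤ) + 1 + c - 1 = M + c by ring] at this
    push_cast
    rw [this, show (M : ℤ) + (c + 1) = M + 1 + c by ring]
    ring

lemma bailey_nat {t : K} (ht : Good t) (N s : ℕ) :
    ∑ j ∈ Finset.range (N + 1), (qp t (N - j))⁻¹ * t ^ (4 * (j : ℤ) ^ 2) *
      (iq t (j - s) * iq t (j + s)) = t ^ (4 * (s : ℤ) ^ 2) * (iq t (N - s) * iq t (N + s)) := by
  rcases lt_or_ge N s with h | h
  · rw [iq_neg t (by omega : (N : ℤ) - s < 0), zero_mul, mul_zero]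
    apply Finset.sum_eq_zero
    intro j hj
    rw [Finset.mem_range] at hj
    rw [iq_neg t (by omega : (j : ℤ) - s < 0), zero_mul, mul_zero]
  · obtain ⟨M, rfl⟩ := Nat.exists_eq_add_of_le h
    rw [add_assoc, Finset.sum_range_add, Finset.sum_eq_zero, zero_add]
    · have hq := qp_ne ht M
      have e : ∀ i ∈ Finset.range (M + 1), (qp t (s + M - (s + i)))⁻¹ * t ^ (4 * ((s + i : ℕ) : ℤ) ^ 2) *
          (iq t (((s + i : ℕ) : ℤ) - s) * iq t (((s + i : ℕ) : ℤ) + s))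
          = t ^ (4 * (s : ℤ) ^ 2) * (qp t M)⁻¹ *
            (t ^ (4 * ((i : ℤ) * (i + 2 * s))) * gauss t M i * iq t (i + 2 * s)) := by
        intro i hi
        rw [Finset.mem_range] at hi
        rw [gauss_eq t (by omega), Int.toNat_natCast, show s + M - (s + i) = M - i by omega,
          show (M : ℤ) - i = ((M - i : ℕ) : ℤ) by omega, iq_nat t (M - i)]
        push_cast
        rw [show (s : ℤ) + i - s = i by ring, show (s : ℤ) + i + s = i + 2 * s by ring]
        have : t ^ (4 * ((s : ℤ) + i) ^ 2) = t ^ (4 * (s : ℤ) ^ 2) * t ^ (4 * ((i : ℤ) * (i + 2 * s))) := by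
          rw [← zpow_add₀ ht.1]; congr 1; ring
        rw [this]
        field_simp
      rw [Finset.sum_congr rfl e, ← Finset.mul_sum, qvander ht]
      push_cast
      rw [show (s : ℤ) + M - s = M by ring, iq_nat, show (s : ℤ) + M + s = M + 2 * s by ring]
      ring
    · intro j hj
      rw [Finset.mem_range] at hj
      rw [iq_neg t (by omega : (j : ℤ) - s < 0), zero_mul, mul_zero]

lemma bailey_fin {t : K} (ht : Good t) (N : ℕ) (s : ℤ) :
    ∑ j ∈ Finset.range (N + 1), (qp t (N - j))⁻¹ * t ^ (4 * (j : ℤ) ^ 2) *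
      (iq t (j - s) * iq t (j + s)) = t ^ (4 * s ^ 2) * (iq t (N - s) * iq t (N + s)) := by
  obtain ⟨n, rfl | rfl⟩ := Int.eq_nat_or_neg s
  · exact bailey_nat ht N n
  · have := bailey_nat ht N n
    simp only [sub_neg_eq_add, ← sub_eq_add_neg, neg_sq]
    rw [mul_comm (iq t ((N : ℤ) + n)), ← this]
    exact Finset.sum_congr rfl fun j _ => by rw [mul_comm (iq t ((j : ℤ) + n))]

def Psi (t : K) (β : ℕ → K) : ℕ → ℕ → K
  | 0 => β
  | k + 1 => fun N => ∑ j ∈ Finset.range (N + 1), (qp t (N - j))⁻¹ * t ^ (4 * (j : ℤ) ^ 2) * Psi t β k j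

lemma Psi_sub (t : K) (c : K) (β γ : ℕ → K) (k : ℕ) : ∀ N,
    Psi t (fun n => c * (β n - γ n)) k N = c * (Psi t β k N - Psi t γ k N) := by
  induction k with
  | zero => intro N; rfl
  | succ k ih =>
    intro N
    simp only [Psi, ih]
    rw [← Finset.sum_sub_distrib, Finset.mul_sum]
    exact Finset.sum_congr rfl fun j _ => by ring

lemma iq_supp {t : K} {N : ℕ} {s : ℤ} (h : iq t (N - s) * iq t (N + s) ≠ 0) : |s| ≤ N := by
  by_contra h'
  rw [abs_le] at h'
  rcases lt_or_ge ((N : ℤ) - s) 0 with h1 | h1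
  · rw [iq_neg t h1, zero_mul] at h; exact h rfl
  · rw [iq_neg t (by omega : (N : ℤ) + s < 0), mul_zero] at h; exact h rfl

lemma iq_fin {t : K} {s : ℤ → ℤ} (hs : ∀ N : ℕ, {j | |s j| ≤ N}.Finite) (α : ℤ → K) (N : ℕ) :
    Function.HasFiniteSupport (fun j => α j * (iq t (N - s j) * iq t (N + s j))) :=
  (hs N).subset fun j hj => iq_supp (t := t) (right_ne_zero_of_mul hj)

lemma Psi_chain {t : K} (ht : Good t) (s : ℤ → ℤ) (hs : ∀ N : ℕ, {j | |s j| ≤ N}.Finite)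
    (α : ℤ → K) (k : ℕ) : ∀ N : ℕ,
    Psi t (fun n => ∑ᶠ j : ℤ, α j * (iq t (n - s j) * iq t (n + s j))) k N
      = ∑ᶠ j : ℤ, (α j * t ^ (4 * (k * (s j) ^ 2))) * (iq t (N - s j) * iq t (N + s j)) := by
  induction k with
  | zero => intro N; simp [Psi]
  | succ k ih =>
    intro N
    simp only [Psi, ih]
    simp only [mul_finsum]
    rw [← finsum_sum_comm]
    · refine finsum_congr fun j => ?_
      have := bailey_fin ht N (s j)
      have e : t ^ (4 * (((k + 1 : ℕ) : ℤ) * (s j) ^ 2)) = t ^ (4 * ((k : ℤ) * (s j) ^ 2)) * t ^ (4 * (s j) ^ 2) := by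
        rw [← zpow_add₀ ht.1]; congr 1; push_cast; ring
      rw [e]
      calc _ = ∑ i ∈ Finset.range (N + 1), (α j * t ^ (4 * ((k : ℤ) * (s j) ^ 2))) *
            ((qp t (N - i))⁻¹ * t ^ (4 * (i : ℤ) ^ 2) * (iq t (i - s j) * iq t (i + s j))) :=
            Finset.sum_congr rfl fun i _ => by ring
        _ = _ := by rw [← Finset.mul_sum, this]; ring
    · intro n _
      exact hfs_mul _ (iq_fin hs _ n)

lemma tadB_cons (k : ℕ) (x : ℤ) (n : Fin k → ℤ) :
    tadB (k + 1) (Fin.cons x n) (Fin.cons x n) = (x + ∑ i, n i) ^ 2 + tadB k n n := by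
  unfold tadB
  rw [Fin.sum_univ_succ]
  simp only [Fin.sum_univ_succ (n := k), Fin.cons_zero, Fin.cons_succ, Fin.val_zero, Fin.val_succ]
  have h1 : ∀ l : Fin k, (min (((0 : ℕ) : ℤ) + 1) (((l + 1 : ℕ) : ℤ) + 1)) = 1 := by intro l; omega
  have h2 : ∀ l : Fin k, (min (((l + 1 : ℕ) : ℤ) + 1) (((0 : ℕ) : ℤ) + 1)) = 1 := by intro l; omega
  have h3 : ∀ i l : Fin k, (min (((i + 1 : ℕ) : ℤ) + 1) (((l + 1 : ℕ) : ℤ) + 1))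
      = 1 + min (((i : ℕ) : ℤ) + 1) (((l : ℕ) : ℤ) + 1) := by intro i l; omega
  simp only [h1, h2, h3, min_self]
  have e : ∀ i l : Fin k, n i * (1 + min (((i : ℕ) : ℤ) + 1) (((l : ℕ) : ℤ) + 1)) * n l
      = n i * n l + n i * (min (((i : ℕ) : ℤ) + 1) (((l : ℕ) : ℤ) + 1)) * n l := by
    intro i l; ring
  simp only [e, Finset.sum_add_distrib, mul_one]
  rw [← Finset.sum_mul_sum, ← Finset.mul_sum, ← Finset.sum_mul]
  push_cast
  ring

lemma mAtN_cons (k x : ℕ) (n : Fin k → ℕ) (hk : 1 ≤ k) :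
    mAtN (k + 1) (Fin.cons x n) (k + 1) = mAtN k n k := by
  unfold mAtN
  rw [Fin.sum_univ_succ]
  simp only [Fin.cons_zero, Fin.cons_succ, Fin.val_zero, Fin.val_succ]
  rw [if_neg (by omega), zero_add]
  exact Finset.sum_congr rfl fun i _ => by simp only [Nat.add_right_cancel_iff]

def tupTerm (t : K) (β : ℕ → K) (k : ℕ) (n : Fin k → ℕ) : K :=
  t ^ (4 * tadB k (fun i => (n i : ℤ)) (fun i => (n i : ℤ)))
    * (∏ i : Fin k, if (i : ℕ) + 1 < k then qp t (n i) else 1)⁻¹ * β (mAtN k n k)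

lemma tupTerm_cons {t : K} (ht : Good t) (β : ℕ → K) (k x : ℕ) (n : Fin k → ℕ) (hk : 1 ≤ k) :
    tupTerm t β (k + 1) (Fin.cons x n) = t ^ (4 * ((x + ∑ i, n i : ℕ) : ℤ) ^ 2) * (qp t x)⁻¹ * tupTerm t β k n := by
  unfold tupTerm
  rw [mAtN_cons k x n hk, Fin.prod_univ_succ]
  have e : (fun i => (((Fin.cons x n : Fin (k + 1) → ℕ) i : ℕ) : ℤ)) = Fin.cons (x : ℤ) (fun i => (n i : ℤ)) := by
    funext i
    refine Fin.cases ?_ (fun i => ?_) i <;> simp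
  rw [e, tadB_cons, mul_add, zpow_add₀ ht.1]
  simp only [Fin.cons_zero, Fin.cons_succ, Fin.val_zero, Fin.val_succ, add_lt_add_iff_right]
  rw [if_pos (by omega), mul_inv]
  push_cast
  ring

lemma tuple_sum {t : K} (ht : Good t) (β : ℕ → K) (k : ℕ) : ∀ N : ℕ,
    ∑ n ∈ Finset.Nat.antidiagonalTuple (k + 1) N, tupTerm t β (k + 1) n
      = t ^ (4 * (N : ℤ) ^ 2) * Psi t β k N := by
  induction k with
  | zero =>
    intro N
    rw [zero_add, Finset.Nat.antidiagonalTuple_one, Finset.sum_singleton]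
    simp [tupTerm, tadB, mAtN, Psi, sq]
  | succ k ih =>
    intro N
    have : ∑ n ∈ Finset.Nat.antidiagonalTuple (k + 1 + 1) N, tupTerm t β (k + 1 + 1) n
        = ∑ j ∈ Finset.range (N + 1), ∑ n ∈ Finset.Nat.antidiagonalTuple (k + 1) j,
          tupTerm t β (k + 1 + 1) (Fin.cons (N - j) n) := by
      rw [Finset.sum_sigma']
      refine Finset.sum_bij' (fun n _ => ⟨∑ i, Fin.tail n i, Fin.tail n⟩)
        (fun p _ => Fin.cons (N - p.1) p.2) ?_ ?_ ?_ ?_ ?_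
      · intro n hn
        rw [Finset.Nat.mem_antidiagonalTuple, Fin.sum_univ_succ] at hn
        simp only [Finset.mem_sigma, Finset.mem_range, Finset.Nat.mem_antidiagonalTuple, and_true]
        simp only [Fin.tail]; omega
      · rintro ⟨j, n⟩ hn
        simp only [Finset.mem_sigma, Finset.mem_range, Finset.Nat.mem_antidiagonalTuple] at hn
        rw [Finset.Nat.mem_antidiagonalTuple, Fin.sum_univ_succ]
        simp only [Fin.cons_zero, Fin.cons_succ]
        omega
      · intro n hn
        rw [Finset.Nat.mem_antidiagonalTuple, Fin.sum_univ_succ] at hn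
        have : N - ∑ i, Fin.tail n i = n 0 := by simp only [Fin.tail]; omega
        simp only [this, Fin.cons_self_tail]
      · rintro ⟨j, n⟩ hn
        simp only [Finset.mem_sigma, Finset.mem_range, Finset.Nat.mem_antidiagonalTuple] at hn
        simp only [Fin.tail_cons, hn.2]
      · intro n hn
        rw [Finset.Nat.mem_antidiagonalTuple, Fin.sum_univ_succ] at hn
        have : N - ∑ i, Fin.tail n i = n 0 := by simp only [Fin.tail]; omega
        simp only [this, Fin.cons_self_tail]
    rw [this]
    simp only [Psi]
    rw [Finset.mul_sum]
    refine Finset.sum_congr rfl fun j hj => ?_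
    rw [Finset.mem_range] at hj
    have e : ∀ n ∈ Finset.Nat.antidiagonalTuple (k + 1) j,
        tupTerm t β (k + 1 + 1) (Fin.cons (N - j) n)
          = t ^ (4 * (N : ℤ) ^ 2) * (qp t (N - j))⁻¹ * tupTerm t β (k + 1) n := by
      intro n hn
      rw [Finset.Nat.mem_antidiagonalTuple] at hn
      rw [tupTerm_cons ht _ _ _ _ (by omega), hn, Nat.sub_add_cancel (by omega)]
    rw [Finset.sum_congr rfl e, ← Finset.mul_sum, ih j]
    ring

/-- `x = O(t^D)`. -/
def OO (D : ℤ) (x : LaurentSeries ℚ) : Prop := Valued.v x ≤ WithZero.exp (-D)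

lemma OO_zero (D : ℤ) : OO D 0 := by simp [OO]

lemma OO_mono {D E : ℤ} {x : LaurentSeries ℚ} (h : OO D x) (hDE : E ≤ D) : OO E x :=
  h.trans (by rw [WithZero.exp_le_exp]; omega)

lemma OO_add {D : ℤ} {x y : LaurentSeries ℚ} (hx : OO D x) (hy : OO D y) : OO D (x + y) :=
  (Valuation.map_add _ _ _).trans (max_le hx hy)

lemma OO_neg {D : ℤ} {x : LaurentSeries ℚ} (hx : OO D x) : OO D (-x) := by
  unfold OO; rw [Valuation.map_neg]; exact hx

lemma OO_sub {D : ℤ} {x y : LaurentSeries ℚ} (hx : OO D x) (hy : OO D y) : OO D (x - y) := by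
  rw [sub_eq_add_neg]; exact OO_add hx (OO_neg hy)

lemma OO_mul {D E : ℤ} {x y : LaurentSeries ℚ} (hx : OO D x) (hy : OO E y) : OO (D + E) (x * y) := by
  unfold OO
  rw [map_mul, neg_add, WithZero.exp_add]
  exact mul_le_mul' hx hy

lemma OO_mul0 {D : ℤ} {x y : LaurentSeries ℚ} (hx : OO D x) (hy : OO 0 y) : OO D (x * y) := by
  simpa using OO_mul hx hy

lemma OO_sum {ι : Type*} {D : ℤ} (s : Finset ι) {f : ι → LaurentSeries ℚ} (h : ∀ i ∈ s, OO D (f i)) :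
    OO D (∑ i ∈ s, f i) := by
  induction s using Finset.induction_on with
  | empty => simpa using OO_zero D
  | insert a s ha ih =>
    rw [Finset.sum_insert ha]
    exact OO_add (h a (Finset.mem_insert_self a s)) (ih fun i hi => h i (Finset.mem_insert_of_mem hi))

lemma v_tL (e : ℤ) : Valued.v (tL ^ e) = WithZero.exp (-e) := by
  rw [map_zpow₀]
  have : Valued.v tL = WithZero.exp (-(1 : ℤ)) := LaurentSeries.valuation_single_zpow ℚ 1
  rw [this, ← WithZero.exp_zsmul]
  congr 1; simp

lemma OO_t (e : ℤ) : OO e (tL ^ e) := (v_tL e).le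

lemma tL_ne : tL ≠ 0 := by
  intro h
  have := v_tL 1
  rw [zpow_one, h, map_zero] at this
  exact WithZero.exp_ne_zero this.symm

lemma v_one_sub (n : ℕ) : Valued.v (1 - tL ^ (4 * (n + 1))) = 1 := by
  apply Valuation.map_one_sub_of_lt
  rw [← zpow_natCast, v_tL, ← WithZero.exp_zero, WithZero.exp_lt_exp]
  push_cast; omega

lemma good_tL : Good tL := by
  refine ⟨tL_ne, fun n h => ?_⟩
  have := v_one_sub n
  rw [h, map_zero] at this
  exact zero_ne_one this

lemma v_qp (n : ℕ) : Valued.v (qp tL n) = 1 := by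
  unfold qp
  rw [map_prod]
  exact Finset.prod_eq_one fun k _ => v_one_sub k

lemma OO_of_v {x : LaurentSeries ℚ} (h : Valued.v x = 1) : OO 0 x := by
  unfold OO; rw [h]; simp

lemma OO_qpinv (n : ℕ) : OO 0 (qp tL n)⁻¹ := OO_of_v (by rw [map_inv₀, v_qp, inv_one])

lemma OO_iq (n : ℤ) : OO 0 (iq tL n) := by
  unfold iq
  split_ifs
  · exact OO_qpinv _
  · exact OO_zero 0

lemma OO_mem_nhds (D : ℤ) : {x | OO D x} ∈ nhds (0 : LaurentSeries ℚ) := by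
  rw [Valued.mem_nhds_zero]
  have h : Valued.v.restrict (tL ^ D) ≠ 0 := by
    intro h
    rw [Valuation.restrict_eq_zero_iff, v_tL] at h
    exact WithZero.exp_ne_zero h
  refine ⟨Units.mk0 _ h, fun x hx => ?_⟩
  simp only [Units.val_mk0, Set.mem_ofPred_eq] at hx
  rw [Valuation.restrict_lt_iff] at hx
  show Valued.v x ≤ _
  rw [← v_tL]; exact hx.le

lemma exists_OO {s : Set (LaurentSeries ℚ)} (hs : s ∈ nhds (0 : LaurentSeries ℚ)) :
    ∃ D : ℤ, ∀ x, OO D x → x ∈ s := by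
  rw [Valued.mem_nhds_zero] at hs
  obtain ⟨γ, hγ⟩ := hs
  have hne : MonoidWithZeroHom.ValueGroup₀.embedding γ.1 ≠ 0 := by
    simp
  refine ⟨1 - WithZero.log (MonoidWithZeroHom.ValueGroup₀.embedding γ.1), fun x hx => hγ ?_⟩
  rw [Set.mem_ofPred_eq, Valuation.restrict_lt_iff_lt_embedding]
  refine lt_of_le_of_lt hx ?_
  rw [← WithZero.lt_log_iff_exp_lt hne]
  omega

def OOgrp (D : ℤ) : AddSubgroup (LaurentSeries ℚ) where
  carrier := {x | OO D x}
  add_mem' := fun hx hy => OO_add hx hy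
  zero_mem' := OO_zero D
  neg_mem' := fun hx => OO_neg hx

lemma OOgrp_open (D : ℤ) : IsOpen (OOgrp D : Set (LaurentSeries ℚ)) :=
  AddSubgroup.isOpen_of_mem_nhds (g := 0) _ (OO_mem_nhds D)

lemma nonarch_L : NonarchimedeanAddGroup (LaurentSeries ℚ) where
  is_nonarchimedean := fun U hU => by
    obtain ⟨D, hD⟩ := exists_OO hU
    exact ⟨⟨OOgrp D, OOgrp_open D⟩, fun x hx => hD x hx⟩

lemma OO_lim {ι : Type*} {l : Filter ι} [l.NeBot] {D : ℤ} {f : ι → LaurentSeries ℚ} {x : LaurentSeries ℚ}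
    (hf : Filter.Tendsto f l (nhds x)) (h : ∀ᶠ i in l, OO D (f i)) : OO D x := by
  have h0 : Filter.Tendsto (fun i => x - f i) l (nhds 0) := by
    simpa using (tendsto_const_nhds (x := x)).sub hf
  obtain ⟨i, h1, h2⟩ := (h.and (h0.eventually (OO_mem_nhds D))).exists
  have := OO_add h2 h1
  simpa using this

lemma tendsto_OO {ι : Type*} {l : Filter ι} {f : ι → LaurentSeries ℚ} {x : LaurentSeries ℚ}
    (h : ∀ D, ∀ᶠ i in l, OO D (f i - x)) : Filter.Tendsto f l (nhds x) := by
  have h0 : Filter.Tendsto (fun i => f i - x) l (nhds 0) := by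
    intro s hs
    obtain ⟨D, hD⟩ := exists_OO hs
    exact (h D).mono fun i hi => hD _ hi
  simpa using h0.add (tendsto_const_nhds (x := x))

lemma summable_OO {ι : Type*} {f : ι → LaurentSeries ℚ} (h : ∀ D, {i | ¬ OO D (f i)}.Finite) :
    Summable f := by
  haveI := nonarch_L
  apply NonarchimedeanAddGroup.summable_of_tendsto_cofinite_zero
  apply tendsto_OO
  intro D
  simpa using (h D)

/-- the limit of `(q)_n` -/
lemma exists_E0 : ∃ E : LaurentSeries ℚ, Filter.Tendsto (qp tL) Filter.atTop (nhds E) := by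
  have hs : Summable (fun n : ℕ => qp tL (n + 1) - qp tL n) := by
    apply summable_OO
    intro D
    apply (Set.finite_lt_nat D.toNat).subset
    intro n hn
    by_contra hc
    apply hn
    have e : qp tL (n + 1) - qp tL n = -(tL ^ ((4 * (n + 1) : ℕ) : ℤ) * qp tL n) := by
      rw [qp_succ, zpow_natCast]; ring
    rw [e]
    refine OO_neg (OO_mono (OO_mul0 (OO_t _) (OO_of_v (v_qp n))) ?_)
    simp only [Set.mem_ofPred_eq] at hc
    push_cast; omega
  refine ⟨(∑' n : ℕ, (qp tL (n + 1) - qp tL n)) + 1, ?_⟩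
  have := (hs.hasSum.tendsto_sum_nat).add (tendsto_const_nhds (x := (1 : LaurentSeries ℚ)))
  refine this.congr fun n => ?_
  rw [Finset.sum_range_sub, qp_zero]; ring

lemma OO_prod_one {D : ℤ} (hD : 0 ≤ D) (s : Finset ℕ) (f : ℕ → LaurentSeries ℚ) (h : ∀ i ∈ s, OO D (f i - 1)) :
    OO D (∏ i ∈ s, f i - 1) := by
  induction s using Finset.induction_on with
  | empty => simpa using OO_zero D
  | insert a s ha ih =>
    rw [Finset.prod_insert ha]
    have h1 := h a (Finset.mem_insert_self a s)
    have h2 := ih fun i hi => h i (Finset.mem_insert_of_mem hi)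
    have e : f a * ∏ i ∈ s, f i - 1 = (f a - 1) * (∏ i ∈ s, f i - 1) + (f a - 1) + (∏ i ∈ s, f i - 1) := by ring
    rw [e]
    exact OO_add (OO_add (OO_mul0 h1 (OO_mono h2 hD)) h1) h2

lemma OO_prod_qp (n : ℕ) (s : Finset ℕ) (hs : Finset.range n ⊆ s) :
    OO (4 * (n + 1)) (∏ k ∈ s, (1 - tL ^ (4 * (k + 1))) - qp tL n) := by
  rw [← Finset.prod_sdiff hs]
  change OO _ (_ * qp tL n - qp tL n)
  have e : ∀ x y : LaurentSeries ℚ, x * y - y = (x - 1) * y := fun x y => by ring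
  rw [e]
  refine OO_mul0 (OO_prod_one (by omega) _ _ fun i hi => ?_) (OO_of_v (v_qp n))
  rw [Finset.mem_sdiff, Finset.mem_range] at hi
  have e : (1 - tL ^ (4 * (i + 1)) - 1 : LaurentSeries ℚ) = -(tL ^ ((4 * (i + 1) : ℕ) : ℤ)) := by
    rw [zpow_natCast]; ring
  rw [e]
  exact OO_neg (OO_mono (OO_t _) (by push_cast; omega))

lemma tendsto_qp : Filter.Tendsto (qp tL) Filter.atTop (nhds eulerInf) := by
  obtain ⟨E, hE⟩ := exists_E0
  have h1 : ∀ n : ℕ, OO (4 * (n + 1)) (E - qp tL n) := by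
    intro n
    refine OO_lim (hE.sub tendsto_const_nhds) (Filter.eventually_atTop.2 ⟨n, fun m hm => ?_⟩)
    exact OO_prod_qp n (Finset.range m) (by simpa using hm)
  have hp : HasProd (fun k : ℕ => (1 - tL ^ (4 * (k + 1)))) E := by
    refine tendsto_OO fun D => ?_
    refine Filter.eventually_atTop.2 ⟨Finset.range D.toNat, fun s hs => ?_⟩
    have := OO_sub (OO_prod_qp _ s hs) (h1 D.toNat)
    refine OO_mono (x := _) (D := 4 * (D.toNat + 1)) ?_ (by omega)
    have e : ∀ x y z : LaurentSeries ℚ, x - y - (z - y) = x - z := fun x y z => by ring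
    rwa [e] at this
  unfold eulerInf
  rw [hp.tprod_eq]
  exact hE

lemma OO_euler (n : ℕ) : OO (4 * (n + 1)) (eulerInf - qp tL n) := by
  refine OO_lim (tendsto_qp.sub tendsto_const_nhds) (Filter.eventually_atTop.2 ⟨n, fun m hm => ?_⟩)
  exact OO_prod_qp n (Finset.range m) (by simpa using hm)

lemma v_euler : Valued.v eulerInf = 1 := by
  have h := OO_neg (OO_euler 0)
  rw [qp_zero] at h
  have e : eulerInf = 1 - -(eulerInf - 1) := by ring
  rw [e]
  apply Valuation.map_one_sub_of_lt
  refine lt_of_le_of_lt h ?_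
  rw [← WithZero.exp_zero, WithZero.exp_lt_exp]
  norm_num

lemma euler_ne : eulerInf ≠ 0 := by
  intro h
  have := v_euler
  rw [h, map_zero] at this
  exact zero_ne_one this

lemma OO_eulerinv : OO 0 eulerInf⁻¹ := OO_of_v (by rw [map_inv₀, v_euler, inv_one])

lemma OO_inv_sub (n : ℕ) : OO (4 * (n + 1)) ((qp tL n)⁻¹ - eulerInf⁻¹) := by
  have e : (qp tL n)⁻¹ - eulerInf⁻¹ = (eulerInf - qp tL n) * (qp tL n)⁻¹ * eulerInf⁻¹ := by
    field_simp [euler_ne, qp_ne good_tL n]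
  rw [e]
  exact OO_mul0 (OO_mul0 (OO_euler n) (OO_qpinv n)) OO_eulerinv

lemma tendsto_iq (s : ℤ) : Filter.Tendsto (fun N : ℕ => iq tL (N + s)) Filter.atTop (nhds eulerInf⁻¹) := by
  refine tendsto_OO fun D => Filter.eventually_atTop.2 ⟨D.toNat + s.natAbs, fun N hN => ?_⟩
  obtain ⟨M, hM⟩ : ∃ M : ℕ, (N : ℤ) + s = M := ⟨(N + s).toNat, by omega⟩
  rw [hM, iq_nat]
  exact OO_mono (OO_inv_sub M) (by omega)

lemma bailey_summable (s : ℤ) :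
    Summable (fun N : ℕ => tL ^ (4 * (N : ℤ) ^ 2) * (iq tL (N - s) * iq tL (N + s))) := by
  apply summable_OO
  intro D
  apply (Set.finite_lt_nat D.toNat).subset
  intro n hn
  by_contra hc
  apply hn
  refine OO_mono (OO_mul0 (OO_t _) (OO_mul0 (OO_iq _) (OO_iq _))) ?_
  simp only [Set.mem_ofPred_eq] at hc
  nlinarith [Int.self_le_toNat D, (by omega : (D.toNat : ℤ) ≤ n)]

lemma bailey_inf (s : ℤ) :
    HasSum (fun N : ℕ => tL ^ (4 * (N : ℤ) ^ 2) * (iq tL (N - s) * iq tL (N + s)))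
      (tL ^ (4 * s ^ 2) * eulerInf⁻¹) := by
  have hs := bailey_summable s
  set f := (fun N : ℕ => tL ^ (4 * (N : ℤ) ^ 2) * (iq tL (N - s) * iq tL (N + s))) with hf
  have h1 : Filter.Tendsto (fun N : ℕ => eulerInf⁻¹ * ∑ j ∈ Finset.range (N + 1), f j) Filter.atTop
      (nhds (eulerInf⁻¹ * ∑' j, f j)) :=
    ((hs.hasSum.tendsto_sum_nat).comp (Filter.tendsto_add_atTop_nat 1)).const_mul _
  have h2 : Filter.Tendsto (fun N : ℕ => tL ^ (4 * s ^ 2) * (iq tL (N - s) * iq tL (N + s))) Filter.atTop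
      (nhds (tL ^ (4 * s ^ 2) * (eulerInf⁻¹ * eulerInf⁻¹))) :=
    (((tendsto_iq (-s)).congr fun N => by rw [sub_eq_add_neg]).mul (tendsto_iq s)).const_mul _
  have h3 : Filter.Tendsto (fun N : ℕ => tL ^ (4 * s ^ 2) * (iq tL (N - s) * iq tL (N + s))) Filter.atTop
      (nhds (eulerInf⁻¹ * ∑' j, f j)) := by
    have h4 : Filter.Tendsto (fun N : ℕ => tL ^ (4 * s ^ 2) * (iq tL (N - s) * iq tL (N + s))
        - eulerInf⁻¹ * ∑ j ∈ Finset.range (N + 1), f j) Filter.atTop (nhds 0) := by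
      refine tendsto_OO fun D => Filter.eventually_atTop.2 ⟨D.toNat, fun N hN => ?_⟩
      rw [sub_zero, ← bailey_fin good_tL, Finset.mul_sum, ← Finset.sum_sub_distrib]
      refine OO_sum _ fun j hj => ?_
      rw [Finset.mem_range] at hj
      have e : (qp tL (N - j))⁻¹ * tL ^ (4 * (j : ℤ) ^ 2) * (iq tL (j - s) * iq tL (j + s)) - eulerInf⁻¹ * f j
          = ((qp tL (N - j))⁻¹ - eulerInf⁻¹) * tL ^ (4 * (j : ℤ) ^ 2) * (iq tL (j - s) * iq tL (j + s)) := by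
        simp only [hf]; ring
      rw [e]
      refine OO_mono (OO_mul0 (OO_mul (OO_inv_sub _) (OO_t _)) (OO_mul0 (OO_iq _) (OO_iq _))) ?_
      have : ((N - j : ℕ) : ℤ) = N - j := by omega
      rw [this]
      have h5 : (j : ℤ) ≤ (j : ℤ) ^ 2 := by
        exact_mod_cast Nat.le_self_pow (by norm_num) j
      omega
    simpa using h4.add h1
  have h4 := tendsto_nhds_unique h2 h3
  have h5 : ∑' j, f j = tL ^ (4 * s ^ 2) * eulerInf⁻¹ := by
    have h6 := euler_ne
    apply mul_left_cancel₀ (inv_ne_zero h6)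
    rw [← h4]; ring
  rw [← h5]
  exact hs.hasSum

lemma OO_finsum {ι : Type*} {D : ℤ} {f : ι → LaurentSeries ℚ} (h : ∀ i, OO D (f i)) :
    OO D (∑ᶠ i, f i) := by
  by_cases hf : (Function.support f).Finite
  · rw [finsum_eq_sum _ hf]
    exact OO_sum _ fun i _ => h i
  · rw [finsum_of_infinite_support hf]
    exact OO_zero D

lemma chain_sum (s : ℤ → ℤ) (hs : ∀ N : ℕ, {j | |s j| ≤ N}.Finite) (α : ℤ → LaurentSeries ℚ)
    (hα : ∀ j, OO 0 (α j)) (k : ℕ) :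
    ∃ S : LaurentSeries ℚ,
      HasSum (fun N : ℕ => tL ^ (4 * (N : ℤ) ^ 2)
        * Psi tL (fun n => ∑ᶠ j, α j * (iq tL (n - s j) * iq tL (n + s j))) k N) S ∧
      HasSum (fun j : ℤ => α j * tL ^ (4 * (((k : ℤ) + 1) * (s j) ^ 2)) * eulerInf⁻¹) S := by
  set g : ℤ × ℕ → LaurentSeries ℚ := fun x => (α x.1 * tL ^ (4 * (k * (s x.1) ^ 2)))
    * (tL ^ (4 * (x.2 : ℤ) ^ 2) * (iq tL (x.2 - s x.1) * iq tL (x.2 + s x.1))) with hg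
  have hG : Summable g := by
    apply summable_OO
    intro D
    apply ((hs D.toNat).prod (Set.finite_lt_nat D.toNat)).subset
    rintro ⟨j, N⟩ hn
    have hN : N < D.toNat := by
      by_contra hc
      apply hn
      have h1 : OO 0 (tL ^ (4 * (k * (s j) ^ 2))) := OO_mono (OO_t _) (by positivity)
      have h2 := OO_mul (OO_mul0 (hα j) h1) (OO_mul0 (OO_t (4 * (N : ℤ) ^ 2))
        (OO_mul0 (OO_iq (N - s j)) (OO_iq (N + s j))))
      refine OO_mono h2 ?_
      nlinarith [Int.self_le_toNat D, (by omega : (D.toNat : ℤ) ≤ N)]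
    refine ⟨?_, hN⟩
    have h0 : g (j, N) ≠ 0 := by
      intro h
      apply hn
      show OO D (g (j, N))
      rw [h]; exact OO_zero D
    simp only [hg] at h0
    have := iq_supp (right_ne_zero_of_mul (right_ne_zero_of_mul h0))
    show |s j| ≤ _
    omega
  refine ⟨∑' x, g x, ?_, ?_⟩
  · have h1 : HasSum (g ∘ (Equiv.prodComm ℕ ℤ)) (∑' x, g x) := (Equiv.hasSum_iff _).2 hG.hasSum
    refine h1.prod_fiberwise fun N => ?_
    rw [Psi_chain good_tL s hs]
    have hfin := iq_fin (t := tL) hs (fun j => α j * tL ^ (4 * (k * (s j) ^ 2))) N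
    have h2 : HasSum (fun j => (α j * tL ^ (4 * (k * (s j) ^ 2))) * (iq tL (N - s j) * iq tL (N + s j)))
        (∑ᶠ j, (α j * tL ^ (4 * (k * (s j) ^ 2))) * (iq tL (N - s j) * iq tL (N + s j))) := by
      rw [finsum_eq_sum _ hfin]
      apply hasSum_sum_of_ne_finset_zero
      intro b hb
      by_contra h
      exact hb (by simpa using h)
    have h3 := h2.mul_left (tL ^ (4 * (N : ℤ) ^ 2))
    have e : (fun j => (g ∘ (Equiv.prodComm ℕ ℤ)) (N, j)) = fun j => tL ^ (4 * (N : ℤ) ^ 2)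
        * ((α j * tL ^ (4 * (k * (s j) ^ 2))) * (iq tL (N - s j) * iq tL (N + s j))) := by
      funext j
      simp only [hg, Function.comp, Equiv.prodComm_apply, Prod.swap]
      ring
    rw [e]
    exact h3
  · refine hG.hasSum.prod_fiberwise fun j => ?_
    have h2 := (bailey_inf (s j)).mul_left (α j * tL ^ (4 * (k * (s j) ^ 2)))
    have e : α j * tL ^ (4 * (((k : ℤ) + 1) * (s j) ^ 2)) * eulerInf⁻¹
        = α j * tL ^ (4 * (k * (s j) ^ 2)) * (tL ^ (4 * (s j) ^ 2) * eulerInf⁻¹) := by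
      rw [add_mul, one_mul, mul_add, zpow_add₀ tL_ne]; ring
    rw [e]
    exact h2

lemma tadB_ge (k : ℕ) (n : Fin k → ℕ) (i : Fin k) :
    (n i : ℤ) ≤ tadB k (fun i => (n i : ℤ)) (fun i => (n i : ℤ)) := by
  unfold tadB
  have hnn : ∀ i l : Fin k, (0 : ℤ) ≤ (n i : ℤ) * (min ((i : ℕ) + 1) ((l : ℕ) + 1) : ℤ) * (n l : ℤ) := by
    intro i l; positivity
  have h1 := Finset.single_le_sum (f := fun i : Fin k => ∑ l : Fin k, (n i : ℤ) * (min ((i : ℕ) + 1) ((l : ℕ) + 1) : ℤ) * (n l : ℤ))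
    (fun i _ => Finset.sum_nonneg fun l _ => hnn i l) (Finset.mem_univ i)
  have h2 := Finset.single_le_sum (f := fun l : Fin k => (n i : ℤ) * (min ((i : ℕ) + 1) ((l : ℕ) + 1) : ℤ) * (n l : ℤ))
    (fun l _ => hnn i l) (Finset.mem_univ i)
  refine le_trans (le_trans ?_ h2) h1
  simp only [min_self]
  have h5 : (n i : ℤ) ≤ (n i : ℤ) ^ 2 := by
    exact_mod_cast Nat.le_self_pow (by norm_num) (n i)
  nlinarith [mul_nonneg (Int.natCast_nonneg (i : ℕ)) (sq_nonneg (n i : ℤ))]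

lemma tup_summable (k : ℕ) (β : ℕ → LaurentSeries ℚ) (D0 : ℤ) (hβ : ∀ n, OO D0 (β n)) :
    Summable (tupTerm tL β k) := by
  apply summable_OO
  intro D
  apply (Set.Finite.pi' (t := fun _ : Fin k => {x : ℕ | x < (D - D0).toNat}) fun _ => Set.finite_lt_nat _).subset
  intro n hn i
  by_contra hc
  apply hn
  have hp : OO 0 (∏ i : Fin k, if (i : ℕ) + 1 < k then qp tL (n i) else 1)⁻¹ := by
    apply OO_of_v
    rw [map_inv₀, map_prod, Finset.prod_eq_one, inv_one]
    intro i _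
    split_ifs
    · exact v_qp _
    · exact map_one _
  have := OO_mul (OO_mul0 (OO_t (4 * tadB k (fun i => (n i : ℤ)) (fun i => (n i : ℤ)))) hp) (hβ (mAtN k n k))
  refine OO_mono this ?_
  have h1 := tadB_ge k n i
  simp only [Set.mem_ofPred_eq] at hc
  omega

lemma tup_sum (k : ℕ) (β : ℕ → LaurentSeries ℚ) (D0 : ℤ) (hβ : ∀ n, OO D0 (β n)) :
    HasSum (fun N : ℕ => tL ^ (4 * (N : ℤ) ^ 2) * Psi tL β k N) (∑' n, tupTerm tL β (k + 1) n) := by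
  have h := (tup_summable (k + 1) β D0 hβ).hasSum
  have h1 := (Equiv.hasSum_iff (Finset.Nat.sigmaAntidiagonalTupleEquivTuple (k + 1))).2 h
  refine h1.sigma fun N => ?_
  rw [← tuple_sum good_tL, ← Finset.sum_coe_sort]
  exact hasSum_fintype _

lemma cast_sum (d : ℕ) (t : K) (u v w : Fin d → ℤ) :
    ∑ᶠ m : Fin d → ℕ, TZ d t u v w (fun i => (m i : ℤ)) = GZ d t u v w := by
  unfold GZ
  have hinj : Function.Injective (fun (m : Fin d → ℕ) (i : Fin d) => (m i : ℤ)) := by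
    intro x y h
    funext i
    have h2 := congrFun h i; simpa using h2
  rw [← finsum_mem_range (f := TZ d t u v w) hinj, ← finsum_mem_univ (TZ d t u v w)]
  apply finsum_mem_inter_support_eq'
  intro m hm
  simp only [Set.mem_univ, iff_true]
  obtain ⟨_, h⟩ := TZ_ne hm
  refine ⟨fun i => (m i).toNat, funext fun i => ?_⟩
  have := (h i).2.1
  simp only
  omega

lemma msum (r a b N : ℕ) (X : LaurentSeries ℚ) (hr : 3 ≤ r) (ha : 1 ≤ a)
    (ha' : a ≤ r - 1) (hb : 1 ≤ b) (hb' : b ≤ r - 2) :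
    (∑' m : Fin (r - 3) → ℕ,
            (if parity r a b m then
              X * tL ^ (quadC (r - 3) m - 2 * mAt (r - 3) m ((r : ℤ) - a - 1))
                * ∏ i : Fin (r - 3), gaussHalf tL (topC r a b (2 * (N : ℤ)) m i) (m i)
            else 0)) = X * FZ (r - 3) tL (r - 1 - a) (2 * N) (r - 1 - b) := by
  set d := r - 3 with hd
  unfold FZ HZ
  rw [← cast_sum]
  set p : ℤ := r - 1 - a with hp
  set l : ℤ := r - 1 - b with hl
  set u : Fin d → ℤ := (fun i => (fun i => 2 * (N : ℤ) * uv d 1 i + uv d l i) i + uv d p i) with hu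
  set w : Fin d → ℤ := (fun i => max p (((i : ℕ) : ℤ) + 1) + max l (((i : ℕ) : ℤ) + 1)) with hw
  have e : ∀ m : Fin d → ℕ, (if parity r a b m then
              X * tL ^ (quadC (r - 3) m - 2 * mAt (r - 3) m ((r : ℤ) - a - 1))
                * ∏ i : Fin (r - 3), gaussHalf tL (topC r a b (2 * (N : ℤ)) m i) (m i)
            else 0) = X * TZ d tL u (uv d p) w (fun i => (m i : ℤ)) := by
    intro m
    unfold TZ
    have hpar : parity r a b m ↔ ∀ i, ((m i : ℤ) - w i) % 2 = 0 := by
      unfold parity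
      refine forall_congr' fun i => ?_
      have hi := i.2
      have : ((Qab r a b i : ℕ) : ℤ) = 2 * (r - 2) - w i := by
        simp only [hw, hp, hl]
        unfold Qab
        have hi' : (i : ℕ) < r - 3 := i.2
        omega
      omega
    rw [if_congr hpar rfl rfl]
    by_cases hh : ∀ i, ((m i : ℤ) - w i) % 2 = 0
    · rw [if_pos hh, if_pos hh, mul_assoc]
      congr 2
      · congr 1
        unfold quadC quadZ mAt
        rw [show (r : ℤ) - a - 1 = p by omega]
      · refine Finset.prod_congr rfl fun i _ => ?_
        congr 1
        unfold topC topZ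
        rw [show (r : ℤ) - a - 1 = p by omega, show (r : ℤ) - b - 1 = l by omega]
        simp only [hu]
        ring
    · rw [if_neg hh, if_neg hh, mul_zero]
  rw [tsum_congr e]
  have hfin : (Function.support fun m : Fin d → ℕ => TZ d tL u (uv d p) w (fun i => (m i : ℤ))).Finite := by
    have hinj : Function.Injective (fun (m : Fin d → ℕ) (i : Fin d) => (m i : ℤ)) := by
      intro x y h
      funext i
      have h2 := congrFun h i; simpa using h2
    exact (TZ_finite d tL u (uv d p) w).preimage hinj.injOn
  rw [tsum_mul_left]
  congr 1
  exact tsum_eq_finsum hfin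

lemma expo1 (d a b : ℕ) (ha : 1 ≤ a) (ha' : a ≤ d + 2) (hb : 1 ≤ b) (hb' : b ≤ d + 1) (j : ℤ) :
    0 ≤ 4 * (j * (((d : ℤ) + 3) * (d + 2) * j + (d + 2) * a - (d + 3) * b)) := by
  have h1 : ((d : ℤ) + 2) * a ≤ (d + 2) * (d + 2) := by gcongr; exact_mod_cast ha'
  have h2 : ((d : ℤ) + 3) * b ≤ (d + 3) * (d + 1) := by gcongr; exact_mod_cast hb'
  have h3 : ((d : ℤ) + 2) * 1 ≤ (d + 2) * a := by gcongr; exact_mod_cast ha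
  have h4 : ((d : ℤ) + 3) * 1 ≤ (d + 3) * b := by gcongr; exact_mod_cast hb
  have hd : (0 : ℤ) ≤ ((d : ℤ) + 3) * (d + 2) := by positivity
  rcases lt_trichotomy j 0 with h | h | h
  · have : ((d : ℤ) + 3) * (d + 2) * j ≤ ((d : ℤ) + 3) * (d + 2) * (-1) := by
      apply mul_le_mul_of_nonneg_left _ hd; omega
    have : 0 ≤ j * (((d : ℤ) + 3) * (d + 2) * j + (d + 2) * a - (d + 3) * b) :=
      mul_nonneg_of_nonpos_of_nonpos h.le (by nlinarith)
    linarith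
  · subst h; simp
  · have : ((d : ℤ) + 3) * (d + 2) * 1 ≤ ((d : ℤ) + 3) * (d + 2) * j := by
      apply mul_le_mul_of_nonneg_left _ hd; omega
    have : 0 ≤ j * (((d : ℤ) + 3) * (d + 2) * j + (d + 2) * a - (d + 3) * b) :=
      mul_nonneg h.le (by nlinarith)
    linarith

lemma expo2 (d a b : ℕ) (ha' : a ≤ d + 2) (hb' : b ≤ d + 1) (j : ℤ) :
    0 ≤ 4 * ((j * ((d : ℤ) + 3) + a) * (j * (d + 2) + b)) := by
  have : 0 ≤ (j * ((d : ℤ) + 3) + a) * (j * (d + 2) + b) := by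
    rcases lt_or_ge j 0 with h | h
    · have h1 : (j + 1) * ((d : ℤ) + 3) ≤ 0 := mul_nonpos_of_nonpos_of_nonneg (by omega) (by omega)
      have h2 : (j + 1) * ((d : ℤ) + 2) ≤ 0 := mul_nonpos_of_nonpos_of_nonneg (by omega) (by omega)
      apply mul_nonneg_of_nonpos_of_nonpos <;> nlinarith
    · positivity
  linarith

lemma main_aux (k d a b : ℕ) (δ ε : ℤ) (ha : 1 ≤ a) (ha' : a ≤ d + 2) (hb : 1 ≤ b) (hb' : b ≤ d + 1)
    (hae : (a : ℤ) = ε + δ) (hbe : (b : ℤ) = ε - δ) :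
    virChar (d + 3) ((k + 1 + 1) * (d + 3) - 1) a ((k + 1 + 1) * b)
      = tL ^ (-(((a : ℤ) - b) * ((a : ℤ) - b - 1)) - ((k : ℤ) + 1) * ((a : ℤ) - b) ^ 2)
        * ∑' n, tupTerm tL (fun n => FZ d tL (d + 2 - a) (2 * n) (d + 2 - b) * (qp tL (2 * n))⁻¹) (k + 1) n := by
  set s1 : ℤ → ℤ := fun j => δ + (d + 3) * j with hs1
  set s2 : ℤ → ℤ := fun j => ε + (d + 3) * j with hs2
  set α1 : ℤ → LaurentSeries ℚ := fun j =>
    tL ^ (4 * (j * (((d : ℤ) + 3) * (d + 2) * j + (d + 2) * a - (d + 3) * b))) with hα1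
  set α2 : ℤ → LaurentSeries ℚ := fun j =>
    tL ^ (4 * ((j * ((d : ℤ) + 3) + a) * (j * (d + 2) + b))) with hα2
  have hO1 : ∀ j, OO 0 (α1 j) := fun j => OO_mono (OO_t _) (expo1 d a b ha ha' hb hb' j)
  have hO2 : ∀ j, OO 0 (α2 j) := fun j => OO_mono (OO_t _) (expo2 d a b ha' hb' j)
  have hf1 : ∀ N : ℕ, {j | |s1 j| ≤ N}.Finite := fun N => fin_abs _ _ _ (by omega)
  have hf2 : ∀ N : ℕ, {j | |s2 j| ≤ N}.Finite := fun N => fin_abs _ _ _ (by omega)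
  set γ1 : ℕ → LaurentSeries ℚ := fun n => ∑ᶠ j, α1 j * (iq tL (n - s1 j) * iq tL (n + s1 j)) with hγ1
  set γ2 : ℕ → LaurentSeries ℚ := fun n => ∑ᶠ j, α2 j * (iq tL (n - s2 j) * iq tL (n + s2 j)) with hγ2
  set c : LaurentSeries ℚ := tL ^ (2 * δ * (2 * δ - 1)) with hc
  have hβ : (fun n : ℕ => FZ d tL (d + 2 - a) (2 * n) (d + 2 - b) * (qp tL (2 * n))⁻¹)
      = fun n => c * (γ1 n - γ2 n) := by
    funext n
    have h := melzer good_tL d δ ε (by omega) (by omega) (by omega) (by omega) n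
    rw [← hae, ← hbe] at h
    exact h
  have hOβ : ∀ n : ℕ, OO (2 * δ * (2 * δ - 1)) (c * (γ1 n - γ2 n)) := fun n =>
    OO_mul0 (OO_t _) (OO_sub
      (OO_finsum fun j => OO_mul0 (hO1 j) (OO_mul0 (OO_iq _) (OO_iq _)))
      (OO_finsum fun j => OO_mul0 (hO2 j) (OO_mul0 (OO_iq _) (OO_iq _))))
  rw [hβ]
  have hT := tup_sum k (fun n => c * (γ1 n - γ2 n)) _ hOβ
  obtain ⟨S1, hA1, hB1⟩ := chain_sum s1 hf1 α1 hO1 k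
  obtain ⟨S2, hA2, hB2⟩ := chain_sum s2 hf2 α2 hO2 k
  have hT2 := (hA1.sub hA2).mul_left c
  have e1 : ∑' n, tupTerm tL (fun n => c * (γ1 n - γ2 n)) (k + 1) n = c * (S1 - S2) := by
    refine hT.unique (Eq.mp ?_ hT2)
    congr 1
    funext N
    rw [Psi_sub]
    ring
  rw [e1]
  set P : LaurentSeries ℚ := tL ^ (-(((a : ℤ) - b) * ((a : ℤ) - b - 1)) - ((k : ℤ) + 1) * ((a : ℤ) - b) ^ 2) with hP
  have hF := ((hB1.sub hB2).mul_left c).mul_left P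
  have h2 := hF.tsum_eq
  rw [← h2]
  unfold virChar
  rw [← tsum_mul_left]
  refine tsum_congr fun j => ?_
  have hp' : (((k + 1 + 1) * (d + 3) - 1 : ℕ) : ℤ) = ((k : ℤ) + 2) * (d + 3) - 1 := by
    rw [Nat.cast_sub (by nlinarith)]; push_cast; ring
  rw [hp']
  have hx : ∀ x y : LaurentSeries ℚ, P * (c * (x * eulerInf⁻¹ - y * eulerInf⁻¹))
      = eulerInf⁻¹ * (P * c * x - P * c * y) := fun x y => by ring
  rw [hx]
  congr 2
  · simp only [hP, hc, hα1, hs1]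
    rw [← zpow_add₀ tL_ne, ← zpow_add₀ tL_ne, ← zpow_add₀ tL_ne, hae, hbe]
    congr 1
    push_cast
    rw [hbe]
    ring
  · simp only [hP, hc, hα2, hs2]
    rw [← zpow_add₀ tL_ne, ← zpow_add₀ tL_ne, ← zpow_add₀ tL_ne, hae, hbe]
    congr 1
    push_cast
    rw [hbe]
    ring

/-- **Rogers–Ramanujan identity for `χ^{(r,(k+1)r-1)}_{a,(k+1)b}(q)`, case `a ≡ b (mod 2)`**
(Bailey chain of length `k` applied to Melzer's identities), stated in the variable
`t = q^{1/4}` (all exponents multiplied by `4`). -/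
theorem bailey_chain_even (k r a b : ℕ) (hk : 1 ≤ k) (hr : 3 ≤ r) (ha : 1 ≤ a)
    (ha' : a ≤ r - 1) (hb : 1 ≤ b) (hb' : b ≤ r - 2) (hab : a % 2 = b % 2) :
    virChar r ((k + 1) * r - 1) a ((k + 1) * b)
      = tL ^ (-(((a : ℤ) - b) * ((a : ℤ) - b - 1)) - (k : ℤ) * ((a : ℤ) - b) ^ 2)
          * ∑' n : Fin k → ℕ, ∑' m : Fin (r - 3) → ℕ,
            (if parity r a b m then
              tL ^ (4 * tadB k (fun i => (n i : ℤ)) (fun i => (n i : ℤ)))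
                * ((∏ i : Fin k, if (i : ℕ) + 1 < k then qp tL (n i) else 1)
                    * qp tL (2 * mAtN k n k))⁻¹
                * tL ^ (quadC (r - 3) m - 2 * mAt (r - 3) m ((r : ℤ) - a - 1))
                * ∏ i : Fin (r - 3),
                    gaussHalf tL (topC r a b (2 * (mAtN k n k : ℤ)) m i) (m i)
            else 0) := by
  obtain ⟨k, rfl⟩ : ∃ k', k = k' + 1 := ⟨k - 1, by omega⟩
  obtain ⟨d, rfl⟩ : ∃ d, r = d + 3 := ⟨r - 3, by omega⟩
  rw [main_aux k d a b (((a : ℤ) - b) / 2) (((a : ℤ) + b) / 2) ha (by omega) hb (by omega) (by omega) (by omega)]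
  push_cast
  congr 1
  refine tsum_congr fun n => ?_
  have hm := msum (d + 3) a b (mAtN (k + 1) n (k + 1))
    (tL ^ (4 * tadB (k + 1) (fun i => (n i : ℤ)) (fun i => (n i : ℤ)))
      * ((∏ i : Fin (k + 1), if (i : ℕ) + 1 < k + 1 then qp tL (n i) else 1)
        * qp tL (2 * mAtN (k + 1) n (k + 1)))⁻¹) hr ha ha' hb hb'
  push_cast at hm
  refine Eq.trans ?_ hm.symm
  unfold tupTerm
  rw [mul_inv, show (d : ℤ) + 3 - 1 - a = d + 2 - a by ring, show (d : ℤ) + 3 - 1 - b = d + 2 - b by ring]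
  simp only [Nat.add_sub_cancel]
  ring
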